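/- arXiv:2303.03741 — 6 statements merged into one kernel-verified Lean document; each statement's English description precedes it below -/
import Mathlib

section
/- Let f : 2^{[n]} → ℝ_{≥0} be a strongly 2-coverage set function with f(∅) = 0. Then the polynomial q_f(y, x_1, …, x_n) = Σ_{i=0}^{n} y^{n+1−i} Σ_{S⊆[n], |S|=i} f(S) Π_{j∈S} x_j in the n+1 variables y, x_1, …, x_n is completely log-concave. -/
open MvPolynomial

/-- The directional derivative `D_a p = ∑ i, a i * ∂_{z i} p`. -/
noncomputable def dirDeriv {n : ℕ} (a : Fin n → ℝ) (p : MvPolynomial (Fin n) ℝ) :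
    MvPolynomial (Fin n) ℝ :=
  ∑ i : Fin n, MvPolynomial.C (a i) * MvPolynomial.pderiv i p

/-- Iterated directional derivatives `D_{a₁} ⋯ D_{a_k} p`. -/
noncomputable def dirDerivs {n : ℕ} (as : List (Fin n → ℝ)) (p : MvPolynomial (Fin n) ℝ) :
    MvPolynomial (Fin n) ℝ :=
  as.foldr dirDeriv p

/-- `p` is nonnegative on the nonnegative orthant and `log p` is concave there
(`x ^ t` denotes the real power `rpow`). -/
def LogConcaveOn {n : ℕ} (p : MvPolynomial (Fin n) ℝ) : Prop :=
  (∀ x : Fin n → ℝ, (∀ i, 0 ≤ x i) → 0 ≤ MvPolynomial.eval x p) ∧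
    ∀ x y : Fin n → ℝ, (∀ i, 0 ≤ x i) → (∀ i, 0 ≤ y i) → ∀ t : ℝ, 0 ≤ t → t ≤ 1 →
      MvPolynomial.eval x p ^ t * MvPolynomial.eval y p ^ (1 - t) ≤
        MvPolynomial.eval (fun i => t * x i + (1 - t) * y i) p

/-- `p` is completely log-concave. -/
def CompletelyLogConcave {n : ℕ} (p : MvPolynomial (Fin n) ℝ) : Prop :=
  ∀ as : List (Fin n → ℝ), (∀ a ∈ as, ∀ i, 0 ≤ a i) → LogConcaveOn (dirDerivs as p)

/-- Generating polynomial of a set function. -/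
noncomputable def genPoly {n : ℕ} (f : Finset (Fin n) → ℝ) : MvPolynomial (Fin n) ℝ :=
  ∑ S : Finset (Fin n), MvPolynomial.C (f S) * ∏ i ∈ S, MvPolynomial.X i

/-- Generating polynomial of a set function restricted to subsets of `V`. -/
noncomputable def genPolyOn {n : ℕ} (V : Finset (Fin n)) (f : Finset (Fin n) → ℝ) :
    MvPolynomial (Fin n) ℝ :=
  ∑ S ∈ V.powerset, MvPolynomial.C (f S) * ∏ i ∈ S, MvPolynomial.X i

/-- The `d`-homogeneous restriction `f^{(d)}` of a set function. -/
def homRestrict {n : ℕ} (f : Finset (Fin n) → ℝ) (d : ℕ) : Finset (Fin n) → ℝ :=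
  fun S => if S.card = d then f S else 0

/-- `g` is a coverage function on subsets of `V`. -/
def IsCoverageOn {n : ℕ} (V : Finset (Fin n)) (g : Finset (Fin n) → ℝ) : Prop :=
  ∃ (m : ℕ) (w : Fin m → ℝ) (A : Fin n → Finset (Fin m)),
    (∀ u, 0 ≤ w u) ∧ ∀ T ⊆ V, g T = ∑ u ∈ T.biUnion A, w u

/-- `ℓ` is a (nonnegative) linear set function on subsets of `V`. -/
def IsLinearOn {n : ℕ} (V : Finset (Fin n)) (ℓ : Finset (Fin n) → ℝ) : Prop :=
  (∀ i ∈ V, 0 ≤ ℓ {i}) ∧ ∀ T ⊆ V, ℓ T = ∑ i ∈ T, ℓ {i}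

/-- `p` cannot be written as a sum of two nonzero polynomials in disjoint sets of variables. -/
def Indecomposable {n : ℕ} (p : MvPolynomial (Fin n) ℝ) : Prop :=
  ¬ ∃ q r : MvPolynomial (Fin n) ℝ, q ≠ 0 ∧ r ≠ 0 ∧ Disjoint q.vars r.vars ∧ p = q + r

/-- `f` is 2-coverage with respect to `d`. -/
def TwoCoverageWrt {n : ℕ} (f : Finset (Fin n) → ℝ) (d : ℕ) : Prop :=
  (∀ τ : Finset (Fin n), τ.card ≤ d - 2 →
      Indecomposable (genPolyOn (Finset.univ \ τ) fun S => homRestrict f d (τ ∪ S))) ∧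
  (∀ τ : Finset (Fin n), τ.card = d - 2 →
      ∃ V : Finset (Fin n), V ⊆ Finset.univ \ τ ∧
        ∃ g ℓ : Finset (Fin n) → ℝ,
          IsCoverageOn V g ∧ IsLinearOn V ℓ ∧ (∀ i ∈ V, ℓ {i} ≤ g {i}) ∧
          ∀ T ⊆ Finset.univ \ τ, T.card = 2 →
            f (τ ∪ T) = if T ⊆ V then g T - ℓ T / 2 else 0)

/-- `f` is strongly 2-coverage. -/
def StronglyTwoCoverage {n : ℕ} (f : Finset (Fin n) → ℝ) : Prop :=
  ∀ τ : Finset (Fin n), τ.card ≤ n - 2 →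
    ∃ g : Finset (Fin n) → ℝ, IsCoverageOn (Finset.univ \ τ) g ∧
      ∀ S ⊆ Finset.univ \ τ, S.Nonempty → S.card ≤ 2 → f (τ ∪ S) = g S + f τ

/-- Monotone set function. -/
def MonotoneSet {n : ℕ} (f : Finset (Fin n) → ℝ) : Prop :=
  ∀ ⦃A B : Finset (Fin n)⦄, A ⊆ B → f A ≤ f B

/-- Submodular set function (diminishing returns). -/
def SubmodularSet {n : ℕ} (f : Finset (Fin n) → ℝ) : Prop :=
  ∀ ⦃S T : Finset (Fin n)⦄, S ⊆ T → ∀ i : Fin n,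
    f (insert i T) - f T ≤ f (insert i S) - f S

/-- `levelSum f i = ∑_{|S| = i} f S`. -/
noncomputable def levelSum {n : ℕ} (f : Finset (Fin n) → ℝ) (i : ℕ) : ℝ :=
  ∑ S ∈ Finset.powersetCard i (Finset.univ : Finset (Fin n)), f S

/-- A matroid on ground set `Fin n`, given by its independent sets. -/
structure FinMatroid (n : ℕ) where
  Indep : Finset (Fin n) → Prop
  indep_empty : Indep ∅
  indep_subset : ∀ ⦃S T : Finset (Fin n)⦄, Indep T → S ⊆ T → Indep S
  indep_exchange : ∀ ⦃S T : Finset (Fin n)⦄, Indep S → Indep T → S.card < T.card →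
    ∃ i ∈ T, i ∉ S ∧ Indep (insert i S)

open Classical in
/-- The rank of `S`: the maximum cardinality of an independent subset of `S`. -/
noncomputable def FinMatroid.rank {n : ℕ} (M : FinMatroid n) (S : Finset (Fin n)) : ℕ :=
  (S.powerset.filter fun T => M.Indep T).sup Finset.card

/-- The homogenization `q_f(y, x₁, …, xₙ) = ∑_{S} f(S) y^{n+1-|S|} ∏_{i∈S} x_i`,
where variable `0` plays the role of `y` and variable `i.succ` the role of `x_i`. -/
noncomputable def homogenization {n : ℕ} (f : Finset (Fin n) → ℝ) :
    MvPolynomial (Fin (n + 1)) ℝ :=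
  ∑ S : Finset (Fin n),
    MvPolynomial.C (f S) * MvPolynomial.X (0 : Fin (n + 1)) ^ (n + 1 - S.card) *
      ∏ i ∈ S, MvPolynomial.X i.succ

section

open Matrix

/-- A symmetric bilinear form which is negative semidefinite on a hyperplane satisfies the reversed
Cauchy-Schwarz inequality for a vector of nonnegative square. -/
theorem mul_le_sq_of_nonpos_on_ker {ι : Type*} [Fintype ι] (A : Matrix ι ι ℝ) (hA : A.IsSymm)
    (l : (ι → ℝ) →ₗ[ℝ] ℝ) (hl : ∀ v, l v = 0 → v ⬝ᵥ A *ᵥ v ≤ 0)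
    (u v : ι → ℝ) (hu : 0 ≤ u ⬝ᵥ A *ᵥ u) :
    (u ⬝ᵥ A *ᵥ u) * (v ⬝ᵥ A *ᵥ v) ≤ (u ⬝ᵥ A *ᵥ v) ^ 2 := by
  rcases hu.eq_or_lt with h0 | hpos
  · rw [← h0, zero_mul]; positivity
  have hlu : l u ≠ 0 := fun h => absurd (hl u h) (not_le.mpr hpos)
  have hx := hl (v - (l v / l u) • u) (by simp [hlu])
  have hsymm : v ⬝ᵥ A *ᵥ u = u ⬝ᵥ A *ᵥ v := by
    rw [dotProduct_mulVec, ← mulVec_transpose, hA.eq, dotProduct_comm]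
  simp only [mulVec_sub, mulVec_smul, dotProduct_sub, sub_dotProduct, smul_dotProduct,
    dotProduct_smul, smul_eq_mul, hsymm] at hx
  nlinarith [sq_nonneg ((l v / l u) * (u ⬝ᵥ A *ᵥ u) - u ⬝ᵥ A *ᵥ v)]

/-- A symmetric nonnegative matrix `B`, all of whose nonzero rows are nonzero in column `h`, is
negative semidefinite on the orthogonal complement of its row sums as soon as its quadratic form is
bounded by the square of the associated random walk operator. -/
theorem nonpos_of_le_sq_div_rowSum {ι : Type*} [Fintype ι] (B : Matrix ι ι ℝ) (hB : B.IsSymm)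
    (hnn : ∀ i j, 0 ≤ B i j) (h : ι) (hconn : ∀ i j, B i j ≠ 0 → B i h ≠ 0)
    (hyp : ∀ x : ι → ℝ, x ⬝ᵥ B *ᵥ x ≤ ∑ i, (B *ᵥ x) i ^ 2 / (B *ᵥ 1) i)
    (x : ι → ℝ) (hx : (B *ᵥ 1) ⬝ᵥ x = 0) : x ⬝ᵥ B *ᵥ x ≤ 0 := by
  classical
  by_contra! hxpos
  set R : ι → ℝ := B *ᵥ 1 with hR
  have hRsum (i) : R i = ∑ j, B i j := by simp [hR, mulVec, dotProduct]
  have hRnn (i) : 0 ≤ R i := by rw [hRsum]; exact Finset.sum_nonneg fun j _ => hnn i j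
  have hrow (i) (hi : R i = 0) (j) : B i j = 0 := by
    rw [hRsum, Finset.sum_eq_zero_iff_of_nonneg fun j _ => hnn i j] at hi
    exact hi j (Finset.mem_univ j)
  have hrow' (i) (hi : R i = 0) (z : ι → ℝ) : (B *ᵥ z) i = 0 := by
    simp [mulVec, dotProduct, hrow i hi]
  have hsymm (u v : ι → ℝ) : v ⬝ᵥ B *ᵥ u = u ⬝ᵥ B *ᵥ v := by
    rw [dotProduct_mulVec, ← mulVec_transpose, hB.eq, dotProduct_comm]
  set W : ι → ℝ := fun i => if R i = 0 then 1 else R i with hW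
  have hWpos (i) : 0 < W i := by
    by_cases hi : R i = 0
    · simp [hW, hi]
    · simpa [hW, hi] using lt_of_le_of_ne (hRnn i) (Ne.symm hi)
  -- the weighted square norm
  set nrm : (ι → ℝ) → ℝ := fun z => ∑ i, W i * z i ^ 2 with hnrm
  have hnrm_pos (z : ι → ℝ) (hz : z ≠ 0) : 0 < nrm z := by
    obtain ⟨i, hi⟩ := Function.ne_iff.mp hz
    refine Finset.sum_pos' (fun j _ => mul_nonneg (hWpos j).le (sq_nonneg _))
      ⟨i, Finset.mem_univ i, mul_pos (hWpos i) (sq_pos_of_ne_zero hi)⟩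
  have hnrm_smul (c : ℝ) (z : ι → ℝ) : nrm (c • z) = c ^ 2 * nrm z := by
    simp only [hnrm, Finset.mul_sum, Pi.smul_apply, smul_eq_mul]
    exact Finset.sum_congr rfl fun i _ => by ring
  have hq_smul (c : ℝ) (z : ι → ℝ) : (c • z) ⬝ᵥ B *ᵥ (c • z) = c ^ 2 * (z ⬝ᵥ B *ᵥ z) := by
    simp only [mulVec_smul, smul_dotProduct, dotProduct_smul, smul_eq_mul]; ring
  set K : Set (ι → ℝ) := {z | R ⬝ᵥ z = 0 ∧ nrm z = 1} with hK
  have hcont_nrm : Continuous nrm := by fun_prop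
  have hKcompact : IsCompact K := by
    refine Metric.isCompact_of_isClosed_isBounded ?_ ?_
    · have hcont : Continuous fun z : ι → ℝ => R ⬝ᵥ z := by
        simp only [dotProduct]; fun_prop
      exact (isClosed_eq hcont continuous_const).inter (isClosed_eq hcont_nrm continuous_const)
    · refine (Metric.isBounded_closedBall (x := (0 : ι → ℝ)) (r := ∑ i, (W i)⁻¹ + 1)).subset ?_
      rintro z ⟨-, hz⟩
      have hsn : 0 ≤ ∑ i, (W i)⁻¹ := Finset.sum_nonneg fun i _ => (inv_pos.mpr (hWpos i)).le
      rw [mem_closedBall_zero_iff, pi_norm_le_iff_of_nonneg (by positivity)]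
      intro i
      have h1 : W i * z i ^ 2 ≤ 1 := by
        rw [← hz]
        exact Finset.single_le_sum (f := fun i => W i * z i ^ 2)
          (fun j _ => mul_nonneg (hWpos j).le (sq_nonneg _)) (Finset.mem_univ i)
      have h2 : z i ^ 2 ≤ (W i)⁻¹ := by
        rwa [← mul_one (W i)⁻¹, ← div_eq_inv_mul, le_div_iff₀' (hWpos i)]
      have h3 : (W i)⁻¹ ≤ ∑ i, (W i)⁻¹ :=
        Finset.single_le_sum (f := fun i => (W i)⁻¹)
          (fun j _ => (inv_pos.mpr (hWpos j)).le) (Finset.mem_univ i)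
      rw [Real.norm_eq_abs]
      refine abs_le_of_sq_le_sq ?_ (by positivity)
      nlinarith
  have hx0 : x ≠ 0 := by rintro rfl; simp at hxpos
  have hKne : K.Nonempty := by
    refine ⟨(√(nrm x))⁻¹ • x, ?_, ?_⟩
    · rw [dotProduct_smul, hx, smul_zero]
    · rw [hnrm_smul, inv_pow, Real.sq_sqrt (hnrm_pos x hx0).le,
        inv_mul_cancel₀ (hnrm_pos x hx0).ne']
  obtain ⟨z, ⟨hz0, hz1⟩, hzmax⟩ := hKcompact.exists_isMaxOn hKne
    (f := fun z => z ⬝ᵥ B *ᵥ z) (by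
      simp only [dotProduct, mulVec]; fun_prop)
  set lam := z ⬝ᵥ B *ᵥ z with hlam
  have hmax (y : ι → ℝ) (hy : R ⬝ᵥ y = 0) : y ⬝ᵥ B *ᵥ y ≤ lam * nrm y := by
    by_cases hy0 : y = 0
    · simp [hy0, hnrm]
    have hp := hnrm_pos y hy0
    have hmem : (√(nrm y))⁻¹ • y ∈ K := by
      refine ⟨by rw [dotProduct_smul, hy, smul_zero], ?_⟩
      rw [hnrm_smul, inv_pow, Real.sq_sqrt hp.le, inv_mul_cancel₀ hp.ne']
    have hle : ((√(nrm y))⁻¹ • y) ⬝ᵥ B *ᵥ ((√(nrm y))⁻¹ • y) ≤ lam := hzmax hmem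
    rwa [hq_smul, inv_pow, Real.sq_sqrt hp.le, inv_mul_le_iff₀ hp, mul_comm] at hle
  have hlampos : 0 < lam := by
    have h1 := hmax x hx
    have h2 := hnrm_pos x hx0
    by_contra! hneg
    nlinarith
  -- the maximiser is an eigenvector
  set y : ι → ℝ := fun i => (B *ᵥ z) i / W i - lam * z i with hy
  have hRy : R ⬝ᵥ y = 0 := by
    have h1 : R ⬝ᵥ y = (1 ⬝ᵥ B *ᵥ z) - lam * (R ⬝ᵥ z) := by
      simp only [dotProduct, hy, Finset.mul_sum, ← Finset.sum_sub_distrib]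
      refine Finset.sum_congr rfl fun i _ => ?_
      by_cases hi : R i = 0
      · simp [hi, hrow' i hi]
      · simp only [hW, hi, if_false, Pi.one_apply]; field_simp
    rw [h1, hz0, ← hsymm, ← hR, dotProduct_comm, hz0]; simp
  have hcross : ∑ i, W i * y i ^ 2 = 0 := by
    have hexp (t : ℝ) : 0 ≤ t * (-2 * ∑ i, W i * y i ^ 2) + t ^ 2 * (lam * nrm y - y ⬝ᵥ B *ᵥ y) := by
      have h1 := hmax (z + t • y) (by rw [dotProduct_add, dotProduct_smul, hz0, hRy]; simp)
      have h2 : nrm (z + t • y) = 1 + 2 * t * (∑ i, W i * z i * y i) + t ^ 2 * nrm y := by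
        rw [← hz1]
        simp only [hnrm, Finset.mul_sum, ← Finset.sum_add_distrib, Pi.add_apply, Pi.smul_apply,
          smul_eq_mul]
        exact Finset.sum_congr rfl fun i _ => by ring
      have h3 : y ⬝ᵥ B *ᵥ z - lam * (∑ i, W i * z i * y i) = ∑ i, W i * y i ^ 2 := by
        simp only [dotProduct, Finset.mul_sum, ← Finset.sum_sub_distrib]
        refine Finset.sum_congr rfl fun i _ => ?_
        have := (hWpos i).ne'
        simp only [hy]; field_simp
      rw [h2] at h1
      simp only [mulVec_add, mulVec_smul, dotProduct_add, add_dotProduct, smul_dotProduct,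
        dotProduct_smul, smul_eq_mul, hsymm y z] at h1
      rw [← h3, hsymm z y]
      rw [hsymm z y, ← hlam] at h1
      nlinarith
    set s := ∑ i, W i * y i ^ 2
    have hs : 0 ≤ s := Finset.sum_nonneg fun j _ => mul_nonneg (hWpos j).le (sq_nonneg _)
    by_contra hne
    have hspos := lt_of_le_of_ne hs (Ne.symm hne)
    set c := lam * nrm y - y ⬝ᵥ B *ᵥ y
    have h1 := hexp (s / (|c| + 1))
    have hc := abs_nonneg c
    have hc' := le_abs_self c
    have ht : 0 < s / (|c| + 1) := by positivity
    have h2 : s / (|c| + 1) * (|c| + 1) = s := by field_simp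
    nlinarith [mul_pos ht ht]
  have heig (i) : (B *ᵥ z) i = lam * (W i * z i) := by
    rw [Finset.sum_eq_zero_iff_of_nonneg fun j _ => mul_nonneg (hWpos j).le (sq_nonneg _)] at hcross
    have := hcross i (Finset.mem_univ i)
    have h2 : y i = 0 := by simpa [(hWpos i).ne'] using this
    have h3 := (hWpos i).ne'
    simp only [hy] at h2
    field_simp at h2
    linarith
  have hlam1 : 1 ≤ lam := by
    have h1 : lam ≤ lam ^ 2 * nrm z := by
      refine (hyp z).trans ?_
      simp only [hnrm, Finset.mul_sum]
      refine Finset.sum_le_sum fun i _ => ?_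
      by_cases hi : R i = 0
      · have := (hWpos i).le
        simp only [hi, div_zero]; positivity
      · rw [heig]; simp only [hW, hi, if_false]; apply le_of_eq; field_simp
    rw [hz1] at h1
    nlinarith
  -- Perron-Frobenius
  have hPF : ∑ i, ∑ j, B i j * (z i - z j) ^ 2 = 2 * (∑ i, R i * z i ^ 2 - lam) := by
    have e1 : ∑ i, ∑ j, B i j * z i ^ 2 = ∑ i, R i * z i ^ 2 :=
      Finset.sum_congr rfl fun i _ => by rw [hRsum, Finset.sum_mul]
    have e2 : ∑ i, ∑ j, B i j * z j ^ 2 = ∑ i, R i * z i ^ 2 := by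
      rw [Finset.sum_comm, ← e1]
      refine Finset.sum_congr rfl fun i _ => Finset.sum_congr rfl fun j _ => by rw [hB.apply]
    have e3 : ∑ i, ∑ j, B i j * (z i * z j) = lam := by
      simp only [hlam, dotProduct, mulVec, Finset.mul_sum]
      refine Finset.sum_congr rfl fun i _ => Finset.sum_congr rfl fun j _ => by ring
    rw [mul_sub, two_mul, ← e3]
    nth_rw 1 [← e1]
    rw [← e2]
    simp only [Finset.mul_sum, ← Finset.sum_add_distrib, ← Finset.sum_sub_distrib]
    refine Finset.sum_congr rfl fun i _ => Finset.sum_congr rfl fun j _ => by ring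
  have hRW : ∑ i, R i * z i ^ 2 ≤ 1 := by
    rw [← hz1]
    refine Finset.sum_le_sum fun i _ => mul_le_mul_of_nonneg_right ?_ (sq_nonneg _)
    by_cases hi : R i = 0 <;> simp [hW, hi]
  have hzero : ∑ i, ∑ j, B i j * (z i - z j) ^ 2 = 0 := by
    refine le_antisymm (by linarith) ?_
    exact Finset.sum_nonneg fun i _ => Finset.sum_nonneg fun j _ =>
      mul_nonneg (hnn i j) (sq_nonneg _)
  have hconst (i) (hi : R i ≠ 0) : z i = z h := by
    obtain ⟨j, hj⟩ : ∃ j, B i j ≠ 0 := by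
      by_contra! hall
      exact hi (by rw [hRsum]; exact Finset.sum_eq_zero fun j _ => hall j)
    rw [Finset.sum_eq_zero_iff_of_nonneg fun i _ => Finset.sum_nonneg fun j _ =>
      mul_nonneg (hnn i j) (sq_nonneg _)] at hzero
    have h1 := hzero i (Finset.mem_univ i)
    rw [Finset.sum_eq_zero_iff_of_nonneg fun j _ => mul_nonneg (hnn i j) (sq_nonneg _)] at h1
    have h2 := h1 h (Finset.mem_univ h)
    simpa [hconn i j hj, sub_eq_zero] using h2
  have hzh : z h * ∑ i, R i = 0 := by
    rw [← hz0, Finset.mul_sum]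
    refine Finset.sum_congr rfl fun i _ => ?_
    by_cases hi : R i = 0
    · simp [hi]
    · rw [hconst i hi, mul_comm]
  have hlam0 : lam = 0 := by
    refine Finset.sum_eq_zero fun i _ => ?_
    by_cases hi : R i = 0
    · rw [hrow' i hi, mul_zero]
    rcases mul_eq_zero.mp hzh with h0 | h0
    · rw [hconst i hi, h0, zero_mul]
    · rw [Finset.sum_eq_zero_iff_of_nonneg fun i _ => hRnn i] at h0
      exact absurd (h0 i (Finset.mem_univ i)) hi
  exact hlampos.ne' hlam0

/-- The variant of `nonpos_of_le_sq_div_rowSum` in which the all-ones vector is replaced by an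
arbitrary positive vector `a`. -/
theorem nonpos_of_le_sq_div {ι : Type*} [Fintype ι] (A : Matrix ι ι ℝ) (hA : A.IsSymm)
    (hnn : ∀ i j, 0 ≤ A i j) (h : ι) (hconn : ∀ i j, A i j ≠ 0 → A i h ≠ 0)
    (a : ι → ℝ) (ha : ∀ i, 0 < a i)
    (hyp : ∀ x : ι → ℝ, x ⬝ᵥ A *ᵥ x ≤ ∑ i, a i * ((A *ᵥ x) i ^ 2 / (A *ᵥ a) i))
    (x : ι → ℝ) (hx : (A *ᵥ a) ⬝ᵥ x = 0) : x ⬝ᵥ A *ᵥ x ≤ 0 := by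
  classical
  set B : Matrix ι ι ℝ := Matrix.of fun i j => a i * A i j * a j with hB
  have hBv (z : ι → ℝ) (i) : (B *ᵥ z) i = a i * (A *ᵥ (a * z)) i := by
    simp only [hB, mulVec, dotProduct, of_apply, Finset.mul_sum, Pi.mul_apply]
    exact Finset.sum_congr rfl fun j _ => by ring
  have hBq (z : ι → ℝ) : z ⬝ᵥ B *ᵥ z = (a * z) ⬝ᵥ A *ᵥ (a * z) := by
    simp only [dotProduct, hBv, Pi.mul_apply]
    exact Finset.sum_congr rfl fun j _ => by ring
  have hxa : a * (x / a) = x := by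
    ext i; have := (ha i).ne'; simp; field_simp
  have key := nonpos_of_le_sq_div_rowSum B ?_ ?_ h ?_ ?_ (x / a) ?_
  · rwa [hBq, hxa] at key
  · ext i j; simp [hB, hA.apply i j]; ring
  · intro i j; simp only [hB, of_apply]
    exact mul_nonneg (mul_nonneg (ha i).le (hnn i j)) (ha j).le
  · intro i j hij
    simp only [hB, of_apply, mul_ne_zero_iff] at hij ⊢
    exact ⟨⟨(ha i).ne', hconn i j hij.1.2⟩, (ha h).ne'⟩
  · intro z
    rw [hBq]
    refine (hyp (a * z)).trans (le_of_eq (Finset.sum_congr rfl fun i _ => ?_))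
    rw [hBv, hBv, mul_one]
    by_cases h0 : (A *ᵥ a) i = 0
    · simp [h0]
    · have := (ha i).ne'; field_simp
  · rw [← hx]
    simp only [dotProduct]
    refine Finset.sum_congr rfl fun i _ => ?_
    rw [hBv, mul_one]
    have := (ha i).ne'
    simp only [Pi.div_apply]; field_simp

theorem pderiv_comm {σ R : Type*} [CommSemiring R] (i j : σ) (p : MvPolynomial σ R) :
    pderiv i (pderiv j p) = pderiv j (pderiv i p) := by
  classical
  ext m
  simp only [coeff_pderiv, Finsupp.add_apply, Finsupp.single_apply]
  rw [add_right_comm]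
  by_cases h : i = j
  · subst h; ring
  · simp [h, Ne.symm h]; ring

section DirDeriv

variable {N : ℕ}

theorem dirDeriv_add (a : Fin N → ℝ) (p q : MvPolynomial (Fin N) ℝ) :
    dirDeriv a (p + q) = dirDeriv a p + dirDeriv a q := by
  simp [dirDeriv, mul_add, Finset.sum_add_distrib]

theorem dirDeriv_C_mul (a : Fin N → ℝ) (c : ℝ) (p : MvPolynomial (Fin N) ℝ) :
    dirDeriv a (C c * p) = C c * dirDeriv a p := by
  simp only [dirDeriv, pderiv_C_mul, Finset.mul_sum]
  exact Finset.sum_congr rfl fun i _ => by ring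

theorem dirDeriv_zero (a : Fin N → ℝ) : dirDeriv a 0 = 0 := by
  simp [dirDeriv]

theorem dirDeriv_sum {ι : Type*} (a : Fin N → ℝ) (s : Finset ι)
    (p : ι → MvPolynomial (Fin N) ℝ) :
    dirDeriv a (∑ i ∈ s, p i) = ∑ i ∈ s, dirDeriv a (p i) := by
  classical
  induction s using Finset.induction_on with
  | empty => simp [dirDeriv_zero]
  | insert i s hi ih => rw [Finset.sum_insert hi, Finset.sum_insert hi, dirDeriv_add, ih]

theorem pderiv_dirDeriv (a : Fin N → ℝ) (i : Fin N) (p : MvPolynomial (Fin N) ℝ) :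
    pderiv i (dirDeriv a p) = dirDeriv a (pderiv i p) := by
  simp only [dirDeriv, map_sum, pderiv_C_mul]
  exact Finset.sum_congr rfl fun j _ => by rw [pderiv_comm]

theorem dirDeriv_comm (a b : Fin N → ℝ) (p : MvPolynomial (Fin N) ℝ) :
    dirDeriv a (dirDeriv b p) = dirDeriv b (dirDeriv a p) := by
  conv_lhs => rw [dirDeriv.eq_1 b, dirDeriv_sum]
  rw [dirDeriv.eq_1 b]
  exact Finset.sum_congr rfl fun i _ => by rw [dirDeriv_C_mul, pderiv_dirDeriv]

theorem dirDerivs_cons (a : Fin N → ℝ) (as : List (Fin N → ℝ)) (p : MvPolynomial (Fin N) ℝ) :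
    dirDerivs (a :: as) p = dirDeriv a (dirDerivs as p) := rfl

theorem dirDerivs_append (as bs : List (Fin N → ℝ)) (p : MvPolynomial (Fin N) ℝ) :
    dirDerivs (as ++ bs) p = dirDerivs as (dirDerivs bs p) := by
  simp [dirDerivs]

theorem dirDerivs_dirDeriv (as : List (Fin N → ℝ)) (a : Fin N → ℝ)
    (p : MvPolynomial (Fin N) ℝ) :
    dirDerivs as (dirDeriv a p) = dirDeriv a (dirDerivs as p) := by
  induction as with
  | nil => rfl
  | cons b as ih => rw [dirDerivs_cons, dirDerivs_cons, ih, dirDeriv_comm]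

theorem pderiv_dirDerivs (as : List (Fin N → ℝ)) (i : Fin N) (p : MvPolynomial (Fin N) ℝ) :
    pderiv i (dirDerivs as p) = dirDerivs as (pderiv i p) := by
  induction as with
  | nil => rfl
  | cons b as ih => rw [dirDerivs_cons, dirDerivs_cons, pderiv_dirDeriv, ih]

theorem dirDerivs_add (as : List (Fin N → ℝ)) (p q : MvPolynomial (Fin N) ℝ) :
    dirDerivs as (p + q) = dirDerivs as p + dirDerivs as q := by
  induction as with
  | nil => rfl
  | cons b as ih => simp only [dirDerivs_cons, ih, dirDeriv_add]

theorem dirDerivs_C_mul (as : List (Fin N → ℝ)) (c : ℝ) (p : MvPolynomial (Fin N) ℝ) :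
    dirDerivs as (C c * p) = C c * dirDerivs as p := by
  induction as with
  | nil => rfl
  | cons b as ih => simp only [dirDerivs_cons, ih, dirDeriv_C_mul]

theorem isHomogeneous_dirDeriv (a : Fin N → ℝ) {p : MvPolynomial (Fin N) ℝ} {d : ℕ}
    (hp : p.IsHomogeneous d) : (dirDeriv a p).IsHomogeneous (d - 1) :=
  IsHomogeneous.sum _ _ _ fun _ _ => hp.pderiv.C_mul _

theorem isHomogeneous_dirDerivs (as : List (Fin N → ℝ)) {p : MvPolynomial (Fin N) ℝ} {d : ℕ}
    (hp : p.IsHomogeneous d) : (dirDerivs as p).IsHomogeneous (d - as.length) := by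
  induction as with
  | nil => exact hp
  | cons b as ih =>
    rw [dirDerivs_cons, List.length_cons, ← Nat.sub_sub]
    exact isHomogeneous_dirDeriv b ih

theorem dirDeriv_eq_zero_of_isHomogeneous_zero (a : Fin N → ℝ) {p : MvPolynomial (Fin N) ℝ}
    (hp : p.IsHomogeneous 0) : dirDeriv a p = 0 := by
  rw [totalDegree_eq_zero_iff_eq_C.mp (Nat.le_zero.mp hp.totalDegree_le)]
  simp [dirDeriv]

theorem eval_dirDeriv_self {p : MvPolynomial (Fin N) ℝ} {d : ℕ} (hp : p.IsHomogeneous d)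
    (z : Fin N → ℝ) : eval z (dirDeriv z p) = d * eval z p := by
  have h := congrArg (eval z) hp.sum_X_mul_pderiv
  simpa [dirDeriv, map_sum] using h

theorem eval_dirDerivs_replicate {p : MvPolynomial (Fin N) ℝ} {d : ℕ} (hp : p.IsHomogeneous d)
    (z : Fin N → ℝ) : eval z (dirDerivs (List.replicate d z) p) = d.factorial * eval z p := by
  induction d generalizing p with
  | zero => simp [dirDerivs]
  | succ d ih =>
    rw [List.replicate_succ, dirDerivs_cons, ← dirDerivs_dirDeriv,
      ih (isHomogeneous_dirDeriv z hp), eval_dirDeriv_self hp, Nat.factorial_succ]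
    push_cast; ring

theorem hasDerivAt_eval_line (p : MvPolynomial (Fin N) ℝ) (x v : Fin N → ℝ) (t : ℝ) :
    HasDerivAt (fun s : ℝ => eval (x + s • v) p) (eval (x + t • v) (dirDeriv v p)) t := by
  induction p using MvPolynomial.induction_on with
  | C c => simpa [dirDeriv] using hasDerivAt_const t c
  | add p q hp hq => simpa only [dirDeriv_add, map_add] using hp.fun_add hq
  | mul_X p i hp =>
    have h1 : HasDerivAt (fun s : ℝ => x i + s * v i) (v i) t := by
      simpa using ((hasDerivAt_id t).mul_const (v i)).const_add (x i)
    have h2 : dirDeriv v (p * X i) = dirDeriv v p * X i + p * C (v i) := by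
      simp only [dirDeriv, pderiv_mul, pderiv_X, mul_add, Finset.sum_add_distrib, Finset.sum_mul]
      congr 1
      · exact Finset.sum_congr rfl fun j _ => by ring
      · rw [Finset.sum_eq_single i]
        · simp [mul_comm]
        · intro j _ hj; simp [hj.symm]
        · simp
    simpa [h2] using hp.fun_mul h1

theorem continuous_eval_dirDerivs (p : MvPolynomial (Fin N) ℝ) (as : List (Fin N → ℝ))
    (e : Fin N → ℝ) (x : ℝ → Fin N → ℝ) (hx : Continuous x) :
    Continuous fun s : ℝ => eval (x s) (dirDerivs (as.map fun a => a + s • e) p) := by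
  induction as generalizing p with
  | nil => exact (MvPolynomial.continuous_eval p).comp hx
  | cons a as ih =>
    have h (s : ℝ) : eval (x s) (dirDerivs ((a :: as).map fun a => a + s • e) p) =
        ∑ i, (a i + s * e i) * eval (x s) (dirDerivs (as.map fun a => a + s • e) (pderiv i p)) := by
      rw [List.map_cons, dirDerivs_cons, dirDeriv]
      simp [pderiv_dirDerivs]
    simp only [h]
    exact continuous_finsetSum _ fun i _ => by have := ih (pderiv i p); fun_prop

end DirDeriv

section Ncoeff

variable {N : ℕ}

/-- The coefficient of `p` at `m` with respect to the divided powers `z ^ m / m!`. -/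
noncomputable def ncoeff (p : MvPolynomial (Fin N) ℝ) (m : Fin N →₀ ℕ) : ℝ :=
  coeff m p * ∏ i, ((m i).factorial : ℝ)

theorem ncoeff_pderiv (p : MvPolynomial (Fin N) ℝ) (i : Fin N) (m : Fin N →₀ ℕ) :
    ncoeff (pderiv i p) m = ncoeff p (m + Finsupp.single i 1) := by
  have h : ∏ j, (((m + Finsupp.single i 1 : Fin N →₀ ℕ) j).factorial : ℝ) =
      (m i + 1) * ∏ j, ((m j).factorial : ℝ) := by
    rw [← Finset.mul_prod_erase _ _ (Finset.mem_univ i),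
      ← Finset.mul_prod_erase _ (fun j => ((m j).factorial : ℝ)) (Finset.mem_univ i), ← mul_assoc]
    congr 1
    · simp [Nat.factorial_succ]
    · refine Finset.prod_congr rfl fun j hj => ?_
      simp [(Finset.ne_of_mem_erase hj).symm]
  rw [ncoeff, ncoeff, coeff_pderiv, h]; ring

theorem ncoeff_dirDeriv (a : Fin N → ℝ) (p : MvPolynomial (Fin N) ℝ) (m : Fin N →₀ ℕ) :
    ncoeff (dirDeriv a p) m = ∑ i, a i * ncoeff p (m + Finsupp.single i 1) := by
  simp only [← ncoeff_pderiv]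
  simp only [ncoeff, dirDeriv, coeff_sum, coeff_C_mul, Finset.sum_mul, mul_assoc]

theorem ncoeff_nonneg_iff {p : MvPolynomial (Fin N) ℝ} {m : Fin N →₀ ℕ} :
    0 ≤ ncoeff p m ↔ 0 ≤ coeff m p := by
  have h : 0 < ∏ i, ((m i).factorial : ℝ) := Finset.prod_pos fun i _ => by positivity
  exact mul_nonneg_iff_of_pos_right h

theorem ncoeff_eq_zero_iff {p : MvPolynomial (Fin N) ℝ} {m : Fin N →₀ ℕ} :
    ncoeff p m = 0 ↔ coeff m p = 0 := by
  have h : 0 < ∏ i, ((m i).factorial : ℝ) := Finset.prod_pos fun i _ => by positivity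
  simp [ncoeff, h.ne']

/-- The Hessian at the origin. -/
noncomputable def hess (p : MvPolynomial (Fin N) ℝ) : Matrix (Fin N) (Fin N) ℝ :=
  fun i j => ncoeff p (Finsupp.single i 1 + Finsupp.single j 1)

theorem hess_isSymm (p : MvPolynomial (Fin N) ℝ) : (hess p).IsSymm := by
  ext i j; simp [hess, add_comm]

theorem dotProduct_hess_mulVec (p : MvPolynomial (Fin N) ℝ) (u v : Fin N → ℝ) :
    u ⬝ᵥ hess p *ᵥ v = constantCoeff (dirDeriv u (dirDeriv v p)) := by
  have h0 (q : MvPolynomial (Fin N) ℝ) : constantCoeff q = ncoeff q 0 := by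
    simp [ncoeff, constantCoeff_eq]
  rw [h0, ncoeff_dirDeriv]
  simp only [ncoeff_dirDeriv, dotProduct, mulVec, hess, zero_add]
  exact Finset.sum_congr rfl fun i _ => by
    congr 1; exact Finset.sum_congr rfl fun j _ => by ring

/-- `p` has nonnegative coefficients, and its support is stable under replacing one factor of a
monomial by `z h`. -/
def IsHub (h : Fin N) (p : MvPolynomial (Fin N) ℝ) : Prop :=
  (∀ m, 0 ≤ ncoeff p m) ∧
    ∀ m i, ncoeff p (m + Finsupp.single i 1) ≠ 0 → ncoeff p (m + Finsupp.single h 1) ≠ 0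

theorem IsHub.pderiv {h : Fin N} {p : MvPolynomial (Fin N) ℝ} (hp : IsHub h p) (i : Fin N) :
    IsHub h (pderiv i p) := by
  refine ⟨fun m => by rw [ncoeff_pderiv]; exact hp.1 _, fun m j hj => ?_⟩
  rw [ncoeff_pderiv, add_right_comm] at hj ⊢
  exact hp.2 _ _ hj

theorem IsHub.dirDeriv {h : Fin N} {p : MvPolynomial (Fin N) ℝ} (hp : IsHub h p)
    {a : Fin N → ℝ} (ha : ∀ i, 0 ≤ a i) : IsHub h (dirDeriv a p) := by
  have hnn (m) (i) : 0 ≤ a i * ncoeff p (m + Finsupp.single i 1) := mul_nonneg (ha i) (hp.1 _)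
  refine ⟨fun m => ?_, fun m j hj hh => ?_⟩
  · rw [ncoeff_dirDeriv]
    exact Finset.sum_nonneg fun i _ => hnn m i
  · rw [ncoeff_dirDeriv] at hj hh
    rw [Finset.sum_eq_zero_iff_of_nonneg fun i _ => hnn _ i] at hh
    refine hj (Finset.sum_eq_zero fun i hi => ?_)
    rcases mul_eq_zero.mp (hh i hi) with h0 | h0
    · rw [h0, zero_mul]
    · by_contra hne
      rw [add_right_comm] at h0 hne
      exact hp.2 _ _ (right_ne_zero_of_mul hne) h0

theorem IsHub.dirDerivs {h : Fin N} {p : MvPolynomial (Fin N) ℝ} (hp : IsHub h p)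
    {as : List (Fin N → ℝ)} (has : ∀ a ∈ as, ∀ i, 0 ≤ a i) : IsHub h (dirDerivs as p) := by
  induction as with
  | nil => exact hp
  | cons a as ih =>
    exact (ih fun b hb => has b (List.mem_cons_of_mem _ hb)).dirDeriv (has a List.mem_cons_self)

/-- The Hessian of `p` at the origin is negative semidefinite on a hyperplane. -/
def HasHyperbolicHess (p : MvPolynomial (Fin N) ℝ) : Prop :=
  ∃ l : (Fin N → ℝ) →ₗ[ℝ] ℝ, ∀ v, l v = 0 → v ⬝ᵥ hess p *ᵥ v ≤ 0

/-- If all partial derivatives of `p` have a hyperbolic Hessian at the origin, then so has the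
derivative of `p` in a positive direction. -/
theorem IsHub.hasHyperbolicHess_dirDeriv {h : Fin N} {p : MvPolynomial (Fin N) ℝ} (hp : IsHub h p)
    {a : Fin N → ℝ} (ha : ∀ i, 0 < a i) (hyp : ∀ i, HasHyperbolicHess (MvPolynomial.pderiv i p)) :
    HasHyperbolicHess (_root_.dirDeriv a p) := by
  have hpa := hp.dirDeriv fun i => (ha i).le
  set A := hess (_root_.dirDeriv a p) with hA
  set T : Fin N → Matrix (Fin N) (Fin N) ℝ := fun k => hess (MvPolynomial.pderiv k p) with hT
  have hTnn (k i j) : 0 ≤ T k i j := (hp.pderiv k).1 _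
  have hAnn (i j) : 0 ≤ A i j := hpa.1 _
  have hAT (i j) : A i j = ∑ k, a k * T k i j := by
    simp only [hA, hT, hess, ncoeff_dirDeriv, ncoeff_pderiv]
  have hTa (k) : T k *ᵥ a = A k := by
    ext j
    simp only [mulVec, dotProduct, hAT]
    refine Finset.sum_congr rfl fun i _ => ?_
    rw [mul_comm]
    simp only [hT, hess, ncoeff_pderiv]; congr 2; abel
  have haT (k) (x : Fin N → ℝ) : a ⬝ᵥ T k *ᵥ x = (A *ᵥ x) k := by
    rw [dotProduct_mulVec, ← mulVec_transpose, (hess_isSymm _).eq, hTa]; rfl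
  have hquad (x : Fin N → ℝ) : x ⬝ᵥ A *ᵥ x = ∑ k, a k * (x ⬝ᵥ T k *ᵥ x) := by
    simp only [dotProduct, mulVec, hAT, Finset.mul_sum, Finset.sum_mul]
    rw [Finset.sum_comm_cycle]
    refine Finset.sum_congr rfl fun k _ => Finset.sum_congr rfl fun i _ =>
      Finset.sum_congr rfl fun j _ => by ring
  refine ⟨LinearMap.lsum ℝ _ ℝ fun i => (A *ᵥ a) i • LinearMap.id, fun v hv => ?_⟩
  refine nonpos_of_le_sq_div A (hess_isSymm _) (fun i j => hpa.1 _) h (fun i j hij => ?_) a ha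
    (fun x => ?_) v ?_
  · exact hpa.2 _ _ hij
  · rw [hquad]
    refine Finset.sum_le_sum fun k _ => mul_le_mul_of_nonneg_left ?_ (ha k).le
    have hnn : 0 ≤ (A *ᵥ a) k := by
      simp only [mulVec, dotProduct]
      exact Finset.sum_nonneg fun j _ => mul_nonneg (hAnn k j) (ha j).le
    rcases hnn.eq_or_lt with h0 | hpos
    · have hT0 (i j) : T k i j = 0 := by
        have h1 : ∑ i, ∑ j, a i * (T k i j * a j) = 0 := by
          rw [h0, ← haT]
          simp only [dotProduct, mulVec, Finset.mul_sum]
        have hnn' (i j) : 0 ≤ a i * (T k i j * a j) :=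
          mul_nonneg (ha i).le (mul_nonneg (hTnn k i j) (ha j).le)
        rw [Finset.sum_eq_zero_iff_of_nonneg fun i _ => Finset.sum_nonneg fun j _ => hnn' i j] at h1
        have h2 := h1 i (Finset.mem_univ i)
        rw [Finset.sum_eq_zero_iff_of_nonneg fun j _ => hnn' i j] at h2
        simpa [(ha i).ne', (ha j).ne'] using h2 j (Finset.mem_univ j)
      have : T k = 0 := by ext i j; exact hT0 i j
      simp [this, ← h0]
    · obtain ⟨l, hl⟩ := hyp k
      have := mul_le_sq_of_nonpos_on_ker (T k) (hess_isSymm _) l hl a x (by rw [haT]; exact hnn)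
      rw [haT, haT] at this
      rwa [le_div_iff₀' hpos]
  · simpa [dotProduct] using hv

/-- Local-to-global principle: if all iterated partial derivatives of order `as.length` have a
hyperbolic Hessian at the origin, then so has the iterated derivative along positive directions
`as`. -/
theorem IsHub.hasHyperbolicHess_dirDerivs {h : Fin N} {p : MvPolynomial (Fin N) ℝ} (hp : IsHub h p)
    {as : List (Fin N → ℝ)} (has : ∀ a ∈ as, ∀ i, 0 < a i)
    (hyp : ∀ L : List (Fin N), L.length = as.length →
      HasHyperbolicHess (L.foldr (fun i q => MvPolynomial.pderiv i q) p)) :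
    HasHyperbolicHess (_root_.dirDerivs as p) := by
  induction as generalizing p with
  | nil => exact hyp [] rfl
  | cons a as ih =>
    have has' : ∀ b ∈ as, ∀ i, 0 < b i := fun b hb => has b (List.mem_cons_of_mem _ hb)
    rw [dirDerivs_cons]
    refine (hp.dirDerivs fun b hb i => (has' b hb i).le).hasHyperbolicHess_dirDeriv
      (has a List.mem_cons_self) fun k => ?_
    rw [pderiv_dirDerivs]
    refine ih (hp.pderiv k) has' fun L hL => ?_
    simpa using hyp (L ++ [k]) (by simp [hL])

end Ncoeff

section LogConcave

variable {N : ℕ}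

/-- The second derivative of `log r` in direction `v` is nonpositive at `z`, if the quadratic form
obtained from `r` by repeated differentiation in direction `z` is hyperbolic. -/
theorem eval_mul_eval_dirDeriv_le {r : MvPolynomial (Fin N) ℝ} {e : ℕ} (hr : r.IsHomogeneous e)
    (z v : Fin N → ℝ) (hz : 0 ≤ eval z r)
    (hyp : ∀ k, k + 2 = e → HasHyperbolicHess (dirDerivs (List.replicate k z) r)) :
    eval z r * eval z (dirDeriv v (dirDeriv v r)) ≤ eval z (dirDeriv v r) ^ 2 := by
  obtain he | ⟨k, rfl⟩ : e ≤ 1 ∨ ∃ k, e = k + 2 := by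
    rcases le_or_gt e 1 with h | h
    · exact Or.inl h
    · exact Or.inr ⟨e - 2, by omega⟩
  · have h0 : (dirDeriv v r).IsHomogeneous 0 := by
      simpa [Nat.sub_eq_zero_of_le he] using isHomogeneous_dirDeriv v hr
    rw [dirDeriv_eq_zero_of_isHomogeneous_zero v h0, map_zero, mul_zero]
    positivity
  set s := dirDerivs (List.replicate k z) r with hs
  have hs2 : s.IsHomogeneous 2 := by simpa using isHomogeneous_dirDerivs (List.replicate k z) hr
  have hcc (u w : Fin N → ℝ) : u ⬝ᵥ hess s *ᵥ w = eval z (dirDeriv u (dirDeriv w s)) := by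
    have h0 : (dirDeriv u (dirDeriv w s)).IsHomogeneous 0 :=
      isHomogeneous_dirDeriv u (isHomogeneous_dirDeriv w hs2)
    rw [dotProduct_hess_mulVec,
      totalDegree_eq_zero_iff_eq_C.mp (Nat.le_zero.mp h0.totalDegree_le)]
    simp
  have hv : (dirDeriv v r).IsHomogeneous (k + 1) := isHomogeneous_dirDeriv v hr
  have hvv : (dirDeriv v (dirDeriv v r)).IsHomogeneous k := isHomogeneous_dirDeriv v hv
  have hrep : ∀ q : MvPolynomial (Fin N) ℝ, dirDeriv z (dirDerivs (List.replicate k z) q) =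
      dirDerivs (List.replicate (k + 1) z) q := fun _ => rfl
  have h1 : z ⬝ᵥ hess s *ᵥ z = (k + 2).factorial * eval z r := by
    rw [hcc, ← eval_dirDerivs_replicate hr z]; rfl
  have h2 : z ⬝ᵥ hess s *ᵥ v = (k + 1).factorial * eval z (dirDeriv v r) := by
    rw [hcc, ← eval_dirDerivs_replicate hv z, hs, ← dirDerivs_dirDeriv]; rfl
  have h3 : v ⬝ᵥ hess s *ᵥ v = k.factorial * eval z (dirDeriv v (dirDeriv v r)) := by
    rw [hcc, ← eval_dirDerivs_replicate hvv z, hs, ← dirDerivs_dirDeriv, ← dirDerivs_dirDeriv]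
  obtain ⟨l, hl⟩ := hyp k rfl
  have h4 := mul_le_sq_of_nonpos_on_ker (hess s) (hess_isSymm s) l hl z v
    (by rw [h1]; positivity)
  rw [h1, h2, h3, Nat.factorial_succ (k + 1), Nat.factorial_succ k] at h4
  push_cast at h4
  have hk : (0 : ℝ) < k.factorial := by positivity
  set φ := eval z r
  set φ₁ := eval z (dirDeriv v r)
  set φ₂ := eval z (dirDeriv v (dirDeriv v r))
  have hK : (0 : ℝ) < (k + 1) * (k.factorial : ℝ) ^ 2 := by positivity
  have h5 : (k + 2 : ℝ) * (φ * φ₂) ≤ (k + 1) * φ₁ ^ 2 := by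
    refine le_of_mul_le_mul_left ?_ hK
    nlinarith
  by_contra! hlt
  have hk0 : (0 : ℝ) ≤ k := k.cast_nonneg
  nlinarith [sq_nonneg φ₁]

theorem eval_nonneg_of_coeff_nonneg {p : MvPolynomial (Fin N) ℝ} (hp : ∀ m, 0 ≤ coeff m p)
    {x : Fin N → ℝ} (hx : ∀ i, 0 ≤ x i) : 0 ≤ eval x p := by
  rw [eval_eq']
  exact Finset.sum_nonneg fun m _ =>
    mul_nonneg (hp m) (Finset.prod_nonneg fun i _ => pow_nonneg (hx i) _)

theorem eval_pos_of_coeff_nonneg {p : MvPolynomial (Fin N) ℝ} (hp : ∀ m, 0 ≤ coeff m p)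
    (hp0 : p ≠ 0) {x : Fin N → ℝ} (hx : ∀ i, 0 < x i) : 0 < eval x p := by
  rw [eval_eq']
  refine Finset.sum_pos (fun m hm => mul_pos ?_ (Finset.prod_pos fun i _ => pow_pos (hx i) _))
    (by rwa [Finset.nonempty_iff_ne_empty, Ne, support_eq_empty])
  exact lt_of_le_of_ne (hp m) (Ne.symm (mem_support_iff.mp hm))

/-- A polynomial with nonnegative coefficients is log-concave on the positive orthant if the second
directional derivatives of its logarithm are nonpositive there. -/
theorem rpow_mul_rpow_le_eval {r : MvPolynomial (Fin N) ℝ} (hnn : ∀ m, 0 ≤ coeff m r)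
    (hyp : ∀ z v : Fin N → ℝ, (∀ i, 0 < z i) →
      eval z r * eval z (dirDeriv v (dirDeriv v r)) ≤ eval z (dirDeriv v r) ^ 2)
    {x y : Fin N → ℝ} (hx : ∀ i, 0 < x i) (hy : ∀ i, 0 < y i) {t : ℝ} (ht0 : 0 ≤ t)
    (ht1 : t ≤ 1) :
    eval x r ^ t * eval y r ^ (1 - t) ≤ eval (fun i => t * x i + (1 - t) * y i) r := by
  by_cases hr : r = 0
  · subst hr
    simp only [map_zero]
    rcases ht0.eq_or_lt with h | h
    · simp [← h]
    · simp [Real.zero_rpow h.ne']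
  set v := x - y with hv
  have hline (s : ℝ) : y + s • v = fun i => s * x i + (1 - s) * y i := by
    ext i; simp [hv]; ring
  have hzpos (s : ℝ) (hs : s ∈ Set.Icc (0 : ℝ) 1) (i) : 0 < (y + s • v) i := by
    rw [hline]
    rcases hs.1.eq_or_lt with h | h
    · simpa [← h] using hy i
    · have := mul_pos h (hx i)
      have := mul_nonneg (sub_nonneg.mpr hs.2) (hy i).le
      simp only; linarith
  have hφpos (s : ℝ) (hs : s ∈ Set.Icc (0 : ℝ) 1) : 0 < eval (y + s • v) r :=
    eval_pos_of_coeff_nonneg hnn hr (hzpos s hs)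
  have hint (s : ℝ) (hs : s ∈ interior (Set.Icc (0 : ℝ) 1)) : 0 < eval (y + s • v) r :=
    hφpos s (interior_subset hs)
  have hconc : ConcaveOn ℝ (Set.Icc (0 : ℝ) 1) fun s => Real.log (eval (y + s • v) r) := by
    refine concaveOn_of_hasDerivWithinAt2_nonpos (convex_Icc 0 1) ?_
      (f' := fun s => eval (y + s • v) (dirDeriv v r) / eval (y + s • v) r)
      (f'' := fun s => (eval (y + s • v) (dirDeriv v (dirDeriv v r)) * eval (y + s • v) r -
        eval (y + s • v) (dirDeriv v r) * eval (y + s • v) (dirDeriv v r)) /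
          eval (y + s • v) r ^ 2) ?_ ?_ ?_
    · exact fun s hs => ((hasDerivAt_eval_line r y v s).log
        (hφpos s hs).ne').continuousAt.continuousWithinAt
    · exact fun s hs => ((hasDerivAt_eval_line r y v s).log (hint s hs).ne').hasDerivWithinAt
    · exact fun s hs => ((hasDerivAt_eval_line _ y v s).fun_div (hasDerivAt_eval_line r y v s)
        (hint s hs).ne').hasDerivWithinAt
    · intro s hs
      have := hyp (y + s • v) v (hzpos s (interior_subset hs))
      refine div_nonpos_of_nonpos_of_nonneg ?_ (sq_nonneg _)
      nlinarith
  have h1 : (1 : ℝ) ∈ Set.Icc (0 : ℝ) 1 := by simp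
  have h0 : (0 : ℝ) ∈ Set.Icc (0 : ℝ) 1 := by simp
  have h := hconc.2 h1 h0 ht0 (sub_nonneg.mpr ht1) (by ring)
  have hxe : y + (1 : ℝ) • v = x := by simp [hv]
  have hye : y + (0 : ℝ) • v = y := by simp
  simp only [smul_eq_mul, mul_one, mul_zero, add_zero, hxe, hye] at h
  have hxp : 0 < eval x r := eval_pos_of_coeff_nonneg hnn hr hx
  have hyp' : 0 < eval y r := eval_pos_of_coeff_nonneg hnn hr hy
  rw [← hline, Real.rpow_def_of_pos hxp, Real.rpow_def_of_pos hyp', ← Real.exp_add,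
    ← Real.le_log_iff_exp_le (hφpos t ⟨ht0, ht1⟩)]
  linarith

theorem IsHub.rpow_mul_rpow_le_eval {h : Fin N} {p : MvPolynomial (Fin N) ℝ} (hp : IsHub h p)
    {d : ℕ} (hd : p.IsHomogeneous d)
    (hyp : ∀ L : List (Fin N), L.length + 2 = d →
      HasHyperbolicHess (L.foldr (fun i q => MvPolynomial.pderiv i q) p))
    {as : List (Fin N → ℝ)} (has : ∀ a ∈ as, ∀ i, 0 < a i)
    {x y : Fin N → ℝ} (hx : ∀ i, 0 < x i) (hy : ∀ i, 0 < y i) {t : ℝ} (ht0 : 0 ≤ t)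
    (ht1 : t ≤ 1) :
    eval x (_root_.dirDerivs as p) ^ t * eval y (_root_.dirDerivs as p) ^ (1 - t) ≤
      eval (fun i => t * x i + (1 - t) * y i) (_root_.dirDerivs as p) := by
  have hr := hp.dirDerivs fun a ha i => (has a ha i).le
  have hnn : ∀ m, 0 ≤ coeff m (_root_.dirDerivs as p) := fun m => ncoeff_nonneg_iff.mp (hr.1 m)
  refine _root_.rpow_mul_rpow_le_eval hnn (fun z v hz => ?_) hx hy ht0 ht1
  have hz0 := eval_nonneg_of_coeff_nonneg hnn fun i => (hz i).le
  refine eval_mul_eval_dirDeriv_le (isHomogeneous_dirDerivs as hd) z v hz0 fun k hk => ?_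
  rw [← dirDerivs_append]
  refine hp.hasHyperbolicHess_dirDerivs (fun a ha => ?_) fun L hL => hyp L ?_
  · rcases List.mem_append.mp ha with h1 | h1
    · rw [List.eq_of_mem_replicate h1]; exact hz
    · exact has a h1
  · simp only [List.length_append, List.length_replicate] at hL
    omega

end LogConcave

section Homogenization

variable {n : ℕ}

/-- `m` is the exponent vector of the monomial of the homogenization indexed by `S`. -/
def IsExponentOf (S : Finset (Fin n)) (m : Fin (n + 1) →₀ ℕ) : Prop :=
  m 0 = n + 1 - S.card ∧ ∀ i : Fin n, m i.succ = if i ∈ S then 1 else 0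

theorem coeff_homogenization (f : Finset (Fin n) → ℝ) (m : Fin (n + 1) →₀ ℕ) :
    coeff m (homogenization f) = ∑ S : Finset (Fin n),
      if Finsupp.single 0 (n + 1 - S.card) + ∑ i ∈ S, Finsupp.single i.succ 1 = m
        then f S else 0 := by
  classical
  rw [homogenization, coeff_sum]
  refine Finset.sum_congr rfl fun S _ => ?_
  have h : C (f S) * X (0 : Fin (n + 1)) ^ (n + 1 - S.card) * ∏ i ∈ S, X i.succ =
      monomial (Finsupp.single 0 (n + 1 - S.card) + ∑ i ∈ S, Finsupp.single i.succ 1) (f S) := by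
    rw [X_pow_eq_monomial, C_mul_monomial, mul_one]
    simp only [X]
    rw [← monomial_sum_one, monomial_mul, mul_one]
  rw [h, coeff_monomial]

theorem exponent_eq_iff (S : Finset (Fin n)) (m : Fin (n + 1) →₀ ℕ) :
    Finsupp.single 0 (n + 1 - S.card) + ∑ i ∈ S, Finsupp.single i.succ 1 = m ↔
      IsExponentOf S m := by
  classical
  rw [Finsupp.ext_iff, Fin.forall_fin_succ, IsExponentOf]
  simp [Finsupp.single_apply, eq_comm]

theorem coeff_homogenization_of_isExponentOf (f : Finset (Fin n) → ℝ) {S : Finset (Fin n)}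
    {m : Fin (n + 1) →₀ ℕ} (h : IsExponentOf S m) : coeff m (homogenization f) = f S := by
  rw [coeff_homogenization, Finset.sum_eq_single S]
  · rw [if_pos ((exponent_eq_iff S m).mpr h)]
  · intro T _ hT
    refine if_neg fun hTm => hT ?_
    have hTm := (exponent_eq_iff T m).mp hTm
    ext i
    have h1 := hTm.2 i
    rw [h.2 i] at h1
    by_cases h2 : i ∈ S <;> by_cases h3 : i ∈ T <;> simp_all
  · simp

theorem exists_of_coeff_homogenization_ne_zero (f : Finset (Fin n) → ℝ)
    {m : Fin (n + 1) →₀ ℕ} (h : coeff m (homogenization f) ≠ 0) : ∃ S, IsExponentOf S m := by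
  rw [coeff_homogenization] at h
  obtain ⟨S, -, hS⟩ := Finset.exists_ne_zero_of_sum_ne_zero h
  refine ⟨S, (exponent_eq_iff S m).mp ?_⟩
  by_contra hne
  exact hS (if_neg hne)

theorem ncoeff_homogenization_of_isExponentOf (f : Finset (Fin n) → ℝ) {S : Finset (Fin n)}
    {m : Fin (n + 1) →₀ ℕ} (h : IsExponentOf S m) :
    ncoeff (homogenization f) m = (m 0).factorial * f S := by
  rw [ncoeff, coeff_homogenization_of_isExponentOf f h, Fin.prod_univ_succ, mul_comm]
  have : ∏ i : Fin n, ((m i.succ).factorial : ℝ) = 1 :=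
    Finset.prod_eq_one fun i _ => by rw [h.2 i]; split_ifs <;> simp
  rw [this, mul_one]

theorem ncoeff_homogenization_eq_zero (f : Finset (Fin n) → ℝ) {m : Fin (n + 1) →₀ ℕ}
    (i : Fin n) (hi : 2 ≤ m i.succ) : ncoeff (homogenization f) m = 0 := by
  rw [ncoeff_eq_zero_iff]
  by_contra h
  obtain ⟨S, hS⟩ := exists_of_coeff_homogenization_ne_zero f h
  rw [hS.2 i] at hi
  split_ifs at hi <;> omega

theorem isHomogeneous_homogenization (f : Finset (Fin n) → ℝ) :
    (homogenization f).IsHomogeneous (n + 1) := by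
  refine IsHomogeneous.sum _ _ _ fun S _ => ?_
  have h1 : (X (0 : Fin (n + 1)) ^ (n + 1 - S.card) : MvPolynomial (Fin (n + 1)) ℝ).IsHomogeneous
      (n + 1 - S.card) := isHomogeneous_X_pow 0 _
  have h2 : (∏ i ∈ S, X i.succ : MvPolynomial (Fin (n + 1)) ℝ).IsHomogeneous S.card := by
    simpa using IsHomogeneous.prod S (fun i : Fin n => (X i.succ : MvPolynomial (Fin (n + 1)) ℝ))
      (fun _ => 1) fun i _ => isHomogeneous_X ℝ i.succ
  have h3 := (h1.C_mul (f S)).mul h2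
  have hS : S.card ≤ n := by simpa using S.card_le_univ
  rwa [Nat.sub_add_cancel (by omega)] at h3

theorem isHub_homogenization {f : Finset (Fin n) → ℝ} (hf : ∀ S, 0 < f S) :
    IsHub 0 (homogenization f) := by
  refine ⟨fun m => ?_, fun m i hi => ?_⟩
  · rw [ncoeff_nonneg_iff, coeff_homogenization]
    exact Finset.sum_nonneg fun S _ => by split_ifs <;> [exact (hf S).le; exact le_rfl]
  · rw [Ne, ncoeff_eq_zero_iff] at hi ⊢
    induction i using Fin.cases with
    | zero => exact hi
    | succ i =>
      obtain ⟨S, hS0, hS⟩ := exists_of_coeff_homogenization_ne_zero f hi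
      have hiS : i ∈ S := by
        by_contra h
        have := hS i
        simp [h] at this
      have hcard : S.card ≤ n := by simpa using S.card_le_univ
      have hcpos : 0 < S.card := Finset.card_pos.mpr ⟨i, hiS⟩
      have hex : IsExponentOf (S.erase i) (m + Finsupp.single 0 1) := by
        refine ⟨?_, fun j => ?_⟩
        · rw [Finset.card_erase_of_mem hiS]
          simp at hS0 ⊢
          omega
        · have := hS j
          by_cases hj : j = i
          · subst hj; simp [hiS] at this; simp [this]
          · simp [Ne.symm hj] at this
            simp [hj, this]
      rw [coeff_homogenization_of_isExponentOf f hex]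
      exact (hf _).ne'

/-- The quadratic form (up to a factorial) of the derivative of the homogenization of `f` with
respect to `∏_{i ∈ τ} x_i` and `n - 1 - |τ|` times `y`. -/
def localForm (f : Finset (Fin n) → ℝ) (τ : Finset (Fin n)) (y : ℝ) (x : Fin n → ℝ) : ℝ :=
  (n - τ.card + 1) * (n - τ.card) * f τ * y ^ 2 +
    2 * (n - τ.card) * y * ∑ i, f (insert i τ) * x i +
    ∑ i, ∑ j, if i = j then 0 else f (insert i (insert j τ)) * (x i * x j)

theorem localForm_add (f g : Finset (Fin n) → ℝ) (τ : Finset (Fin n)) (y : ℝ) (x : Fin n → ℝ) :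
    localForm (f + g) τ y x = localForm f τ y x + localForm g τ y x := by
  have h (i j : Fin n) : (if i = j then 0 else (f + g) (insert i (insert j τ)) * (x i * x j)) =
      (if i = j then 0 else f (insert i (insert j τ)) * (x i * x j)) +
      (if i = j then 0 else g (insert i (insert j τ)) * (x i * x j)) := by
    split_ifs <;> simp [add_mul]
  simp only [localForm, h, Finset.sum_add_distrib]
  simp only [Pi.add_apply, add_mul, Finset.sum_add_distrib]
  ring

/-- The local quadratic form of `f` at each `τ` is negative semidefinite on the hyperplane
`(n - |τ|) y + ∑ i, x i = 0`; unlike hyperbolicity alone, this is stable under sums. -/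
def LocallyHyperbolic (f : Finset (Fin n) → ℝ) : Prop :=
  ∀ τ : Finset (Fin n), τ.card + 2 ≤ n → ∀ (y : ℝ) (x : Fin n → ℝ), (∀ i ∈ τ, x i = 0) →
    (n - τ.card) * y + ∑ i, x i = 0 → localForm f τ y x ≤ 0

theorem LocallyHyperbolic.add {f g : Finset (Fin n) → ℝ} (hf : LocallyHyperbolic f)
    (hg : LocallyHyperbolic g) : LocallyHyperbolic (f + g) := fun τ hτ y x hx h => by
  rw [localForm_add]
  exact add_nonpos (hf τ hτ y x hx h) (hg τ hτ y x hx h)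

theorem StronglyTwoCoverage.locallyHyperbolic {f : Finset (Fin n) → ℝ} (hf : ∀ S, 0 ≤ f S)
    (hcov : StronglyTwoCoverage f) : LocallyHyperbolic f := by
  intro τ hτ y x hx hyx
  obtain ⟨g, ⟨m, w, A, hw, hg⟩, hfg⟩ := hcov τ (by omega)
  set χ : Fin m → Fin n → ℝ := fun u i => if u ∈ A i then 1 else 0 with hχ
  set G : Fin n → ℝ := fun i => ∑ u, w u * χ u i with hG
  set H : Fin n → Fin n → ℝ := fun i j => ∑ u, w u * (χ u i * χ u j) with hH
  have hHG (i) : H i i = G i := by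
    refine Finset.sum_congr rfl fun u _ => ?_
    simp only [hχ]; split_ifs <;> simp
  have hG0 (i) : 0 ≤ G i := Finset.sum_nonneg fun u _ => mul_nonneg (hw u) (by
    simp only [hχ]; split_ifs <;> simp)
  have hins1 (i) (hi : i ∉ τ) : f (insert i τ) = f τ + G i := by
    have hsub : ({i} : Finset (Fin n)) ⊆ Finset.univ \ τ := by simpa using hi
    have h1 := hfg {i} hsub (Finset.singleton_nonempty i) (by simp)
    rw [Finset.union_comm, ← Finset.insert_eq, hg _ hsub] at h1
    rw [h1, add_comm, Finset.singleton_biUnion]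
    simp [hG, hχ]
  have hins2 (i j) (hi : i ∉ τ) (hj : j ∉ τ) :
      f (insert i (insert j τ)) = f τ + G i + G j - H i j := by
    have hsub : ({i, j} : Finset (Fin n)) ⊆ Finset.univ \ τ := by
      intro k; simp only [Finset.mem_insert, Finset.mem_singleton]
      rintro (rfl | rfl) <;> simpa
    have h1 := hfg {i, j} hsub (Finset.insert_nonempty _ _) Finset.card_le_two
    have h2 : τ ∪ {i, j} = insert i (insert j τ) := by ext k; simp
    rw [h2, hg _ hsub] at h1
    have h3 : ∑ u ∈ ({i, j} : Finset (Fin n)).biUnion A, w u = G i + G j - H i j := by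
      simp only [hG, hH, ← Finset.sum_add_distrib, ← Finset.sum_sub_distrib]
      have h4 : ∑ u ∈ ({i, j} : Finset (Fin n)).biUnion A, w u =
          ∑ u, if u ∈ ({i, j} : Finset (Fin n)).biUnion A then w u else 0 := by
        rw [Finset.sum_ite_mem, Finset.univ_inter]
      rw [h4]
      refine Finset.sum_congr rfl fun u _ => ?_
      by_cases hui : u ∈ A i <;> by_cases huj : u ∈ A j <;> simp [hχ, hui, huj]
    rw [h1, h3]; ring
  have hx1 (i) : f (insert i τ) * x i = (f τ + G i) * x i := by
    by_cases hi : i ∈ τ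
    · simp [hx i hi]
    · rw [hins1 i hi]
  have hx2 (i j) : (if i = j then 0 else f (insert i (insert j τ)) * (x i * x j)) =
      (f τ + G i + G j - H i j) * (x i * x j) - if i = j then (f τ + G i) * x i ^ 2 else 0 := by
    by_cases hij : i = j
    · subst hij; simp only [if_true, hHG]; ring
    · by_cases hi : i ∈ τ
      · simp [hx i hi, hij]
      by_cases hj : j ∈ τ
      · simp [hx j hj, hij]
      simp [hij, hins2 i j hi hj]
  set c := f τ
  set X := ∑ i, x i
  set GX := ∑ i, G i * x i
  set k : ℝ := n - τ.card with hk
  have hxH : ∑ i, ∑ j, H i j * (x i * x j) = ∑ u, w u * (∑ i, χ u i * x i) ^ 2 := by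
    simp only [hH, sq, Finset.mul_sum, Finset.sum_mul]
    rw [Finset.sum_comm_cycle]
    exact Finset.sum_congr rfl fun u _ => Finset.sum_congr rfl fun i _ =>
      Finset.sum_congr rfl fun j _ => by ring
  have hxH0 : 0 ≤ ∑ i, ∑ j, H i j * (x i * x j) := by
    rw [hxH]; exact Finset.sum_nonneg fun u _ => mul_nonneg (hw u) (sq_nonneg _)
  have hGx2 : 0 ≤ ∑ i, G i * x i ^ 2 :=
    Finset.sum_nonneg fun i _ => mul_nonneg (hG0 i) (sq_nonneg _)
  have hform : localForm f τ y x = c * ((k + 1) * k * y ^ 2 + 2 * k * y * X + X ^ 2 -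
      ∑ i, x i ^ 2) + 2 * (k * y + X) * GX - (∑ i, ∑ j, H i j * (x i * x j)) -
      ∑ i, G i * x i ^ 2 := by
    have e1 : ∑ i, f (insert i τ) * x i = c * X + GX := by
      simp only [hx1, add_mul, Finset.sum_add_distrib, ← Finset.mul_sum]; rfl
    have e2 : (∑ i, ∑ j, if i = j then 0 else f (insert i (insert j τ)) * (x i * x j)) =
        c * X ^ 2 + 2 * X * GX - (∑ i, ∑ j, H i j * (x i * x j)) - c * (∑ i, x i ^ 2) -
          ∑ i, G i * x i ^ 2 := by
      have e3 : ∑ i, ∑ j, c * (x i * x j) = c * X ^ 2 := by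
        rw [sq, show X * X = ∑ i, ∑ j, x i * x j from Finset.sum_mul_sum ..]
        simp only [Finset.mul_sum]
      have e4 : ∑ i, ∑ j, (G i * x i) * x j = GX * X := by rw [← Finset.sum_mul_sum]
      have e5 : ∑ i, ∑ j, x i * (G j * x j) = X * GX := by rw [← Finset.sum_mul_sum]
      have e6 : ∑ i, ∑ j, (if i = j then (c + G i) * x i ^ 2 else 0) =
          c * (∑ i, x i ^ 2) + ∑ i, G i * x i ^ 2 := by
        simp [add_mul, Finset.sum_add_distrib, Finset.mul_sum]
      have e7 : c * X ^ 2 + 2 * X * GX - (∑ i, ∑ j, H i j * (x i * x j)) - c * (∑ i, x i ^ 2) -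
          ∑ i, G i * x i ^ 2 = c * X ^ 2 + GX * X + X * GX - (∑ i, ∑ j, H i j * (x i * x j)) -
          (c * (∑ i, x i ^ 2) + ∑ i, G i * x i ^ 2) := by ring
      rw [e7, ← e3, ← e4, ← e5, ← e6]
      simp only [hx2, ← Finset.sum_add_distrib, ← Finset.sum_sub_distrib]
      exact Finset.sum_congr rfl fun i _ => Finset.sum_congr rfl fun j _ => by ring
    rw [localForm, e1, e2]; ring
  have hcs : X ^ 2 ≤ k * ∑ i, x i ^ 2 := by
    have e1 : X = ∑ i ∈ τᶜ, x i :=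
      (Finset.sum_subset (Finset.subset_univ _) fun i _ hi => hx i (by simpa using hi)).symm
    have e2 : ∑ i ∈ τᶜ, x i ^ 2 ≤ ∑ i, x i ^ 2 :=
      Finset.sum_le_sum_of_subset_of_nonneg (Finset.subset_univ _) fun i _ _ => sq_nonneg _
    have e3 : ((τᶜ.card : ℕ) : ℝ) = k := by
      rw [Finset.card_compl, Fintype.card_fin, Nat.cast_sub (by omega)]
    have hkn : 0 ≤ k := by rw [← e3]; positivity
    rw [e1]
    refine sq_sum_le_card_mul_sum_sq.trans ?_
    rw [e3]
    exact mul_le_mul_of_nonneg_left e2 hkn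
  have hkpos : 0 < k := by
    have : (τ.card : ℝ) + 2 ≤ n := by exact_mod_cast hτ
    linarith
  have hX : X = -(k * y) := by linarith
  have hmain : (k + 1) * k * y ^ 2 + 2 * k * y * X + X ^ 2 - ∑ i, x i ^ 2 ≤ 0 := by
    have : k * y ^ 2 ≤ ∑ i, x i ^ 2 := by
      rw [hX] at hcs
      refine le_of_mul_le_mul_left ?_ hkpos
      linarith
    rw [hX]; nlinarith
  have := mul_nonpos_of_nonneg_of_nonpos (hf τ) hmain
  rw [hform, hyx]
  linarith

theorem stronglyTwoCoverage_mul_one_add_card {ε : ℝ} (hε : 0 ≤ ε) :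
    StronglyTwoCoverage fun S : Finset (Fin n) => ε * (1 + S.card) := by
  intro τ _
  refine ⟨fun S => ε * S.card, ⟨n, fun _ => ε, fun i => {i}, fun _ => hε, fun T _ => ?_⟩,
    fun S hS _ _ => ?_⟩
  · simp [Finset.biUnion_singleton_eq_self, mul_comm]
  · have hd : Disjoint τ S := by
      rw [Finset.disjoint_right]
      intro i hi
      simpa using hS hi
    simp only [Finset.card_union_of_disjoint hd]
    push_cast; ring

/-- Iterated partial derivatives shift the divided power coefficients. -/
theorem ncoeff_foldr_pderiv {N : ℕ} (p : MvPolynomial (Fin N) ℝ) (L : List (Fin N)) :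
    ∃ α : Fin N →₀ ℕ, ∑ i, α i = L.length ∧
      ∀ m, ncoeff (L.foldr (fun i q => pderiv i q) p) m = ncoeff p (m + α) := by
  induction L with
  | nil => exact ⟨0, by simp, by simp⟩
  | cons i L ih =>
    obtain ⟨α, hα, h⟩ := ih
    refine ⟨Finsupp.single i 1 + α, ?_, fun m => ?_⟩
    · simp [Finset.sum_add_distrib, hα, Finsupp.single_apply, add_comm]
    · rw [List.foldr_cons, ncoeff_pderiv, h, add_assoc]
/-- The entries of the Hessian of the derivative of `homogenization f` with respect to
`∏_{i ∈ τ} x_i` and `α 0 = n - 1 - |τ|` times `y`. -/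
theorem hess_eq_of_ncoeff_eq (f : Finset (Fin n) → ℝ) {q : MvPolynomial (Fin (n + 1)) ℝ}
    {α : Fin (n + 1) →₀ ℕ} {τ : Finset (Fin n)}
    (hq : ∀ m, ncoeff q m = ncoeff (homogenization f) (m + α))
    (h0 : α 0 + 1 + τ.card = n) (hτ : ∀ i : Fin n, α i.succ = if i ∈ τ then 1 else 0) :
    hess q 0 0 = (α 0 + 2).factorial * f τ ∧
    (∀ i : Fin n, hess q 0 i.succ =
      if i ∈ τ then 0 else (α 0 + 1).factorial * f (insert i τ)) ∧
    ∀ i j : Fin n, hess q i.succ j.succ =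
      if i ∈ τ ∨ j ∈ τ ∨ i = j then 0 else (α 0).factorial * f (insert i (insert j τ)) := by
  refine ⟨?_, fun i => ?_, fun i j => ?_⟩
  · rw [hess, hq, ncoeff_homogenization_of_isExponentOf f (S := τ)]
    · simp [add_comm]
    · refine ⟨?_, fun j => by simp [hτ]⟩
      simp; omega
  · rw [hess, hq]
    split_ifs with hi
    · refine ncoeff_homogenization_eq_zero f i ?_
      simp [hτ, hi]
    · rw [ncoeff_homogenization_of_isExponentOf f (S := insert i τ)]
      · simp [add_comm]
      · refine ⟨?_, fun j => ?_⟩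
        · rw [Finset.card_insert_of_notMem hi]; simp; omega
        · by_cases hj : j = i
          · subst hj; simp [hτ, hi]
          · simp [hτ, hj]
  · rw [hess, hq]
    by_cases hi : i ∈ τ
    · rw [if_pos (Or.inl hi)]
      refine ncoeff_homogenization_eq_zero f i ?_
      simp [hτ, hi]
    by_cases hj : j ∈ τ
    · rw [if_pos (Or.inr (Or.inl hj))]
      refine ncoeff_homogenization_eq_zero f j ?_
      simp [hτ, hj]
    by_cases hij : i = j
    · rw [if_pos (Or.inr (Or.inr hij))]
      refine ncoeff_homogenization_eq_zero f j ?_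
      simp [hij]
    rw [if_neg (by tauto), ncoeff_homogenization_of_isExponentOf f (S := insert i (insert j τ))]
    · simp
    · refine ⟨?_, fun k => ?_⟩
      · rw [Finset.card_insert_of_notMem (by simp [hi, hij]), Finset.card_insert_of_notMem hj]
        simp; omega
      · by_cases hki : k = i
        · subst hki; simp [hτ, hi, Ne.symm hij]
        · by_cases hkj : k = j
          · subst hkj; simp [hτ, hj, hij]
          · simp [hτ, hki, hkj]

theorem LocallyHyperbolic.hasHyperbolicHess {f : Finset (Fin n) → ℝ} (hf : LocallyHyperbolic f)
    {L : List (Fin (n + 1))} (hL : L.length + 2 = n + 1) :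
    HasHyperbolicHess (L.foldr (fun i q => pderiv i q) (homogenization f)) := by
  obtain ⟨α, hα, hq⟩ := ncoeff_foldr_pderiv (homogenization f) L
  set q := L.foldr (fun i q => pderiv i q) (homogenization f)
  by_cases h2 : ∃ i : Fin n, 2 ≤ α i.succ
  · obtain ⟨i, hi⟩ := h2
    refine ⟨0, fun v _ => ?_⟩
    have h0 : hess q = 0 := by
      ext a b
      rw [hess, hq]
      refine ncoeff_homogenization_eq_zero f i ?_
      rw [Finsupp.add_apply]; omega
    simp [h0]
  push Not at h2
  set τ : Finset (Fin n) := Finset.univ.filter fun i => α i.succ = 1 with hτdef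
  have hτ (i : Fin n) : α i.succ = if i ∈ τ then 1 else 0 := by
    have := h2 i
    by_cases h : α i.succ = 1
    · simp [hτdef, h]
    · simp [hτdef, h]; omega
  have hcard : α 0 + 1 + τ.card = n := by
    rw [Fin.sum_univ_succ] at hα
    simp only [hτ, Finset.sum_ite_mem, Finset.univ_inter, Finset.sum_const, smul_eq_mul,
      mul_one] at hα
    omega
  obtain ⟨h00, h0s, hss⟩ := hess_eq_of_ncoeff_eq f hq hcard hτ
  have hs0 (i : Fin n) : hess q i.succ 0 = hess q 0 i.succ := (hess_isSymm q).apply 0 i.succ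
  set π : (Fin (n + 1) → ℝ) → Fin n → ℝ := fun v i => if i ∈ τ then 0 else v i.succ with hπ
  have hform (v : Fin (n + 1) → ℝ) :
      v ⬝ᵥ hess q *ᵥ v = (α 0).factorial * localForm f τ (v 0) (π v) := by
    have ha : (n : ℝ) - τ.card = α 0 + 1 := by
      have : ((α 0 + 1 + τ.card : ℕ) : ℝ) = n := by rw [hcard]
      push_cast at this; linarith
    have e1 (i : Fin n) : hess q 0 i.succ * v i.succ =
        (α 0 + 1).factorial * (f (insert i τ) * π v i) := by
      rw [h0s]; simp only [hπ]; split_ifs <;> simp [mul_assoc]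
    have e2 (i j : Fin n) : v i.succ * (hess q i.succ j.succ * v j.succ) = (α 0).factorial *
        if i = j then 0 else f (insert i (insert j τ)) * (π v i * π v j) := by
      rw [hss]; simp only [hπ]
      by_cases hi : i ∈ τ <;> by_cases hj : j ∈ τ <;> by_cases hij : i = j <;>
        simp [hi, hj, hij]
      ring
    simp only [dotProduct, mulVec, Fin.sum_univ_succ, hs0, mul_add, Finset.mul_sum,
      Finset.sum_add_distrib, e2]
    have e3 (i : Fin n) : v i.succ * (hess q 0 i.succ * v 0) = v 0 * (hess q 0 i.succ * v i.succ) :=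
      by ring
    simp only [e3, e1, h00, localForm, ha, Nat.factorial_succ, ← Finset.mul_sum]
    push_cast
    ring
  by_cases hτn : τ.card + 2 ≤ n
  · refine ⟨((n : ℝ) - τ.card) • LinearMap.proj 0 +
      ∑ i, if i ∈ τ then 0 else LinearMap.proj i.succ, fun v hv => ?_⟩
    rw [hform]
    refine mul_nonpos_of_nonneg_of_nonpos (Nat.cast_nonneg _)
      (hf τ hτn _ _ (fun i hi => by simp [hπ, hi]) ?_)
    rw [← hv]
    simp only [hπ, LinearMap.add_apply, LinearMap.smul_apply, LinearMap.proj_apply, smul_eq_mul,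
      LinearMap.sum_apply]
    congr 1
    exact Finset.sum_congr rfl fun i _ => by split_ifs <;> simp
  · refine ⟨LinearMap.proj 0, fun v hv => ?_⟩
    have hv0 : v 0 = 0 := hv
    have hτc : τᶜ.card ≤ 1 := by
      rw [Finset.card_compl, Fintype.card_fin]; omega
    rw [hform, localForm, hv0]
    have : (∑ i, ∑ j, if i = j then 0 else f (insert i (insert j τ)) * (π v i * π v j)) = 0 := by
      refine Finset.sum_eq_zero fun i _ => Finset.sum_eq_zero fun j _ => ?_
      by_cases hij : i = j
      · simp [hij]
      by_cases hi : i ∈ τ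
      · simp [hπ, hi]
      by_cases hj : j ∈ τ
      · simp [hπ, hj]
      exact absurd (Finset.card_le_one.mp hτc i (by simpa) j (by simpa)) hij
    rw [this]; simp

theorem homogenization_add_mul (f g : Finset (Fin n) → ℝ) (s : ℝ) :
    homogenization (f + fun S => s * g S) = homogenization f + C s * homogenization g := by
  simp only [homogenization, Finset.mul_sum, ← Finset.sum_add_distrib]
  exact Finset.sum_congr rfl fun S _ => by simp only [Pi.add_apply, C_add, C_mul]; ring

end Homogenization

end

/-- For a strongly 2-coverage set function `f` with `f ∅ = 0`,
the polynomial `q_f` is completely log-concave. -/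
theorem stmt_1 {n : ℕ} (f : Finset (Fin n) → ℝ) (hf : ∀ S, 0 ≤ f S) (hf0 : f ∅ = 0)
    (hcov : StronglyTwoCoverage f) :
    CompletelyLogConcave (homogenization f) := by
  intro as has
  set g : Finset (Fin n) → ℝ := fun S => 1 + S.card
  set P : ℝ → MvPolynomial (Fin (n + 1)) ℝ := fun s =>
    dirDerivs (as.map fun a => a + s • 1) (homogenization (f + fun S => s * g S)) with hP
  have hP0 : P 0 = dirDerivs as (homogenization f) := by simp [hP, homogenization_add_mul]
  have hcont (x : Fin (n + 1) → ℝ) : Continuous fun s : ℝ => eval (x + s • 1) (P s) := by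
    have hx : Continuous fun s : ℝ => x + s • (1 : Fin (n + 1) → ℝ) := by fun_prop
    simp only [hP, homogenization_add_mul, dirDerivs_add, dirDerivs_C_mul, map_add, map_mul,
      eval_C]
    exact (continuous_eval_dirDerivs _ as 1 _ hx).add
      (continuous_id.mul (continuous_eval_dirDerivs _ as 1 _ hx))
  have hlim (x : Fin (n + 1) → ℝ) : Filter.Tendsto (fun s : ℝ => eval (x + s • 1) (P s))
      (nhdsWithin 0 (Set.Ioi 0)) (nhds (eval x (dirDerivs as (homogenization f)))) := by
    have := (hcont x).tendsto 0
    rw [zero_smul, add_zero, hP0] at this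
    exact this.mono_left nhdsWithin_le_nhds
  have hshift {x : Fin (n + 1) → ℝ} {s : ℝ} (hs : 0 < s) (hx : ∀ i, 0 ≤ x i) (i) :
      0 < (x + s • (1 : Fin (n + 1) → ℝ)) i := by simpa using add_pos_of_nonneg_of_pos (hx i) hs
  have hshift' {s : ℝ} (hs : 0 < s) (a : Fin (n + 1) → ℝ)
      (ha : a ∈ as.map fun a => a + s • 1) (i) : 0 < a i := by
    obtain ⟨b, hb, rfl⟩ := List.mem_map.mp ha
    exact hshift hs (has b hb) i
  have hhub {s : ℝ} (hs : 0 < s) : IsHub 0 (homogenization (f + fun S => s * g S)) :=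
    isHub_homogenization fun S => add_pos_of_nonneg_of_pos (hf S) (by positivity)
  refine ⟨fun x hx => ge_of_tendsto (hlim x) ?_, fun x y hx hy t ht0 ht1 => ?_⟩
  · filter_upwards [self_mem_nhdsWithin] with s hs
    have hnn := ((hhub hs).dirDerivs fun a ha i => (hshift' hs a ha i).le).1
    exact eval_nonneg_of_coeff_nonneg (fun m => ncoeff_nonneg_iff.mp (hnn m))
      fun i => (hshift hs hx i).le
  · refine le_of_tendsto_of_tendsto
      (((hlim x).rpow_const (Or.inr ht0)).mul ((hlim y).rpow_const (Or.inr (sub_nonneg.mpr ht1))))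
      (hlim fun i => t * x i + (1 - t) * y i) ?_
    filter_upwards [self_mem_nhdsWithin] with s hs
    have hlh : LocallyHyperbolic (f + fun S => s * g S) :=
      (hcov.locallyHyperbolic hf).add ((stronglyTwoCoverage_mul_one_add_card
        (le_of_lt hs)).locallyHyperbolic fun S => mul_nonneg (le_of_lt hs) (by positivity))
    have h := (hhub hs).rpow_mul_rpow_le_eval (isHomogeneous_homogenization _)
      (fun L hL => hlh.hasHyperbolicHess hL) (hshift' hs) (hshift hs hx) (hshift hs hy) ht0 ht1
    refine h.trans_eq ?_
    congr 2
    ext i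
    simp; ring
end

section
/- If f : 2^{[n]} → ℝ_{≥0} is a coverage function, or a nonnegative linear combination of rank functions of matroids on the ground set [n], then the sequence f_0, f_1, …, f_n defined by f_i = Σ_{S⊆[n], |S|=i} f(S) is ultra log-concave, i.e., for every k with 1 < k < n, (f_k / C(n+1,k))² ≥ (f_{k−1} / C(n+1,k−1)) · (f_{k+1} / C(n+1,k+1)). -/
open MvPolynomial

/-- Two sets of equal size have the same sum of values over their images under all permutations. -/
theorem sum_perm_map_eq_of_card_eq {n : ℕ} (f : Finset (Fin n) → ℝ) {A B : Finset (Fin n)}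
    (h : A.card = B.card) :
    ∑ σ : Equiv.Perm (Fin n), f (A.map σ.toEmbedding) =
      ∑ σ : Equiv.Perm (Fin n), f (B.map σ.toEmbedding) := by
  obtain ⟨τ, hτ⟩ : ∃ τ : Equiv.Perm (Fin n), A.map τ.toEmbedding = B := by
    let e : {x // x ∈ A} ≃ {x // x ∈ B} := Finset.equivOfCardEq h
    refine ⟨e.extendSubtype, Finset.eq_of_subset_of_card_le ?_ (by simp [h])⟩
    intro x hx
    obtain ⟨y, hy, rfl⟩ := Finset.mem_map.1 hx
    exact e.extendSubtype_mem y hy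
  rw [← hτ]
  refine (Fintype.sum_equiv (Equiv.mulRight τ) _ _ fun σ => ?_).symm
  rw [Finset.map_map]
  rfl

/-- Averaging `f` over the images of `A` under all permutations is averaging over the level
of `A`. -/
theorem choose_mul_sum_perm_map {n : ℕ} (f : Finset (Fin n) → ℝ) (A : Finset (Fin n)) :
    (n.choose A.card : ℝ) * ∑ σ : Equiv.Perm (Fin n), f (A.map σ.toEmbedding) =
      (n.factorial : ℝ) * levelSum f A.card := by
  have hperm (σ : Equiv.Perm (Fin n)) :
      ∑ B ∈ Finset.powersetCard A.card Finset.univ, f (B.map σ.toEmbedding) =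
        levelSum f A.card := by
    refine Finset.sum_equiv σ.finsetCongr (fun B => ?_) fun B _ => rfl
    simp [Finset.mem_powersetCard]
  calc (n.choose A.card : ℝ) * ∑ σ : Equiv.Perm (Fin n), f (A.map σ.toEmbedding)
      = ∑ B ∈ Finset.powersetCard A.card (Finset.univ : Finset (Fin n)),
          ∑ σ : Equiv.Perm (Fin n), f (B.map σ.toEmbedding) := by
        rw [Finset.sum_congr rfl fun B hB =>
          sum_perm_map_eq_of_card_eq f (Finset.mem_powersetCard.1 hB).2]
        simp
    _ = (n.factorial : ℝ) * levelSum f A.card := by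
        rw [Finset.sum_comm, Finset.sum_congr rfl fun σ _ => hperm σ]
        simp [Fintype.card_perm]

/-- The level averages of a submodular function form a concave sequence. -/
theorem levelSum_div_choose_concave {n : ℕ} {f : Finset (Fin n) → ℝ}
    (hf : ∀ S T, f (S ∪ T) + f (S ∩ T) ≤ f S + f T) {m : ℕ} (hm : m + 2 ≤ n) :
    levelSum f m / (n.choose m : ℝ) + levelSum f (m + 2) / (n.choose (m + 2) : ℝ) ≤
      2 * (levelSum f (m + 1) / (n.choose (m + 1) : ℝ)) := by
  have average (A : Finset (Fin n)) : levelSum f A.card / (n.choose A.card : ℝ) =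
      (∑ σ : Equiv.Perm (Fin n), f (A.map σ.toEmbedding)) / (n.factorial : ℝ) := by
    have hc : (n.choose A.card : ℝ) ≠ 0 :=
      Nat.cast_ne_zero.2 (Nat.choose_pos (by simpa using A.card_le_univ)).ne'
    rw [div_eq_div_iff hc (Nat.cast_ne_zero.2 n.factorial_ne_zero), mul_comm,
      ← choose_mul_sum_perm_map, mul_comm]
  obtain ⟨T, -, hT⟩ := Finset.exists_subset_card_eq
    (s := (Finset.univ : Finset (Fin n))) (n := m + 2) (by simpa using hm)
  obtain ⟨a, ha, b, hb, hab⟩ := Finset.one_lt_card.1 (show 1 < T.card by omega)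
  have hA : (T.erase a).card = m + 1 := by rw [Finset.card_erase_of_mem ha]; omega
  have hB : (T.erase b).card = m + 1 := by rw [Finset.card_erase_of_mem hb]; omega
  have hAB : ((T.erase a) ∩ (T.erase b)).card = m := by
    have : T.erase a ∩ T.erase b = (T.erase a).erase b := by ext; simp; tauto
    rw [this, Finset.card_erase_of_mem (by simp [hb, hab.symm])]
    omega
  have hU : T.erase a ∪ T.erase b = T := by
    ext x
    simp only [Finset.mem_union, Finset.mem_erase]
    grind
  have key : levelSum f ((T.erase a) ∩ (T.erase b)).card /
        (n.choose ((T.erase a) ∩ (T.erase b)).card : ℝ) +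
      levelSum f T.card / (n.choose T.card : ℝ) ≤
      levelSum f (T.erase a).card / (n.choose (T.erase a).card : ℝ) +
      levelSum f (T.erase b).card / (n.choose (T.erase b).card : ℝ) := by
    simp only [average, ← add_div, ← Finset.sum_add_distrib]
    refine div_le_div_of_nonneg_right (Finset.sum_le_sum fun σ _ => ?_) (Nat.cast_nonneg _)
    have := hf ((T.erase a).map σ.toEmbedding) ((T.erase b).map σ.toEmbedding)
    rw [← Finset.map_union, ← Finset.map_inter, hU] at this
    linarith
  rw [hA, hB, hAB, hT] at key
  linarith

/-- The level sums of a nonnegative submodular function form an ultra log-concave sequence. -/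
theorem levelSum_ultra_log_concave {n : ℕ} {f : Finset (Fin n) → ℝ} (h0 : ∀ S, 0 ≤ f S)
    (hf : ∀ S T, f (S ∪ T) + f (S ∩ T) ≤ f S + f T) {m : ℕ} (hm : m + 2 ≤ n) :
    (levelSum f m / ((n + 1).choose m : ℝ)) * (levelSum f (m + 2) / ((n + 1).choose (m + 2) : ℝ)) ≤
      (levelSum f (m + 1) / ((n + 1).choose (m + 1) : ℝ)) ^ 2 := by
  have rescale {i : ℕ} (hi : i ≤ n) : levelSum f i / ((n + 1).choose i : ℝ) =
      levelSum f i / (n.choose i : ℝ) * ((n + 1 - i) / (n + 1)) := by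
    have h := Nat.choose_mul_succ_eq n i
    have h' : (n.choose i : ℝ) * (n + 1) = (n + 1).choose i * (n + 1 - i) := by
      have := congrArg (Nat.cast (R := ℝ)) h
      push_cast [Nat.cast_sub (show i ≤ n + 1 by omega)] at this
      exact this
    have h1 : (n.choose i : ℝ) ≠ 0 := Nat.cast_ne_zero.2 (Nat.choose_pos hi).ne'
    have h2 : ((n + 1).choose i : ℝ) ≠ 0 :=
      Nat.cast_ne_zero.2 (Nat.choose_pos (by omega)).ne'
    have h3 : (n + 1 : ℝ) ≠ 0 := by positivity
    rw [div_mul_div_comm, div_eq_div_iff h2 (mul_ne_zero h1 h3), h']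
    ring
  have nonneg (i : ℕ) : 0 ≤ levelSum f i / (n.choose i : ℝ) :=
    div_nonneg (Finset.sum_nonneg fun S _ => h0 S) (Nat.cast_nonneg _)
  have hconc := levelSum_div_choose_concave hf hm
  rw [rescale (by omega), rescale hm, rescale (by omega)]
  have hx := nonneg m
  have hy := nonneg (m + 1)
  have hz := nonneg (m + 2)
  set x := levelSum f m / (n.choose m : ℝ)
  set y := levelSum f (m + 1) / (n.choose (m + 1) : ℝ)
  set z := levelSum f (m + 2) / (n.choose (m + 2) : ℝ)
  have hxz : x * z ≤ y ^ 2 := by nlinarith [sq_nonneg (x - z)]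
  have hmn : (m : ℝ) + 2 ≤ n := by exact_mod_cast hm
  push_cast
  calc x * ((n + 1 - m) / (n + 1)) * (z * ((n + 1 - (m + 2)) / (n + 1)))
      = x * z * (((n + 1 - m) * (n + 1 - (m + 2))) / (n + 1) ^ 2) := by field_simp
    _ ≤ y ^ 2 * ((n + 1 - (m + 1)) ^ 2 / (n + 1) ^ 2) := by
        gcongr
        · exact div_nonneg (mul_nonneg (by linarith) (by linarith)) (sq_nonneg _)
        · nlinarith
    _ = (y * ((n + 1 - (m + 1)) / (n + 1))) ^ 2 := by field_simp

theorem IsCoverageOn.nonneg {n : ℕ} {f : Finset (Fin n) → ℝ}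
    (h : IsCoverageOn Finset.univ f) (S : Finset (Fin n)) : 0 ≤ f S := by
  obtain ⟨m, w, A, hw, hA⟩ := h
  rw [hA S (Finset.subset_univ S)]
  exact Finset.sum_nonneg fun u _ => hw u

theorem IsCoverageOn.union_add_inter_le {n : ℕ} {f : Finset (Fin n) → ℝ}
    (h : IsCoverageOn Finset.univ f) (S T : Finset (Fin n)) :
    f (S ∪ T) + f (S ∩ T) ≤ f S + f T := by
  obtain ⟨m, w, A, hw, hA⟩ := h
  simp only [hA _ (Finset.subset_univ _)]
  rw [Finset.union_biUnion,
    ← Finset.sum_union_inter (s₁ := S.biUnion A) (s₂ := T.biUnion A)]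
  refine add_le_add le_rfl ?_
  refine Finset.sum_le_sum_of_subset_of_nonneg (fun u hu => ?_) fun u _ _ => hw u
  simp only [Finset.mem_biUnion, Finset.mem_inter] at hu ⊢
  obtain ⟨i, ⟨hS, hT⟩, hi⟩ := hu
  exact ⟨⟨i, hS, hi⟩, ⟨i, hT, hi⟩⟩

theorem FinMatroid.card_le_rank {n : ℕ} (M : FinMatroid n) {I S : Finset (Fin n)}
    (hI : M.Indep I) (hIS : I ⊆ S) : I.card ≤ M.rank S := by
  classical
  exact Finset.le_sup (f := Finset.card) (by simp [hI, hIS])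

theorem FinMatroid.exists_indep_card_eq_rank {n : ℕ} (M : FinMatroid n) (S : Finset (Fin n)) :
    ∃ I ⊆ S, M.Indep I ∧ I.card = M.rank S := by
  classical
  obtain ⟨I, hI, h⟩ := Finset.exists_mem_eq_sup (S.powerset.filter fun T => M.Indep T)
    ⟨∅, by simp [M.indep_empty]⟩ Finset.card
  rw [Finset.mem_filter, Finset.mem_powerset] at hI
  refine ⟨I, hI.1, hI.2, ?_⟩
  rw [← h]
  unfold FinMatroid.rank
  congr!

/-- Every independent subset of `S` extends to a basis of `S`. -/
theorem FinMatroid.exists_superset_card_eq_rank {n : ℕ} (M : FinMatroid n)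
    {I S : Finset (Fin n)} (hI : M.Indep I) (hIS : I ⊆ S) :
    ∃ J, I ⊆ J ∧ J ⊆ S ∧ M.Indep J ∧ J.card = M.rank S := by
  classical
  obtain ⟨J, hJ, hmax⟩ := Finset.exists_max_image
    (S.powerset.filter fun J => I ⊆ J ∧ M.Indep J) Finset.card ⟨I, by simp [hI, hIS]⟩
  simp only [Finset.mem_filter, Finset.mem_powerset] at hJ hmax
  obtain ⟨hJS, hIJ, hJi⟩ := hJ
  refine ⟨J, hIJ, hJS, hJi, (M.card_le_rank hJi hJS).antisymm ?_⟩
  by_contra! hlt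
  obtain ⟨K, hKS, hK, hKr⟩ := M.exists_indep_card_eq_rank S
  obtain ⟨i, hiK, hiJ, hi⟩ := M.indep_exchange hJi hK (hKr ▸ hlt)
  have := hmax (insert i J) ⟨Finset.insert_subset (hKS hiK) hJS,
    hIJ.trans (Finset.subset_insert i J), hi⟩
  rw [Finset.card_insert_of_notMem hiJ] at this
  omega

theorem FinMatroid.rank_union_add_rank_inter_le {n : ℕ} (M : FinMatroid n)
    (S T : Finset (Fin n)) : M.rank (S ∪ T) + M.rank (S ∩ T) ≤ M.rank S + M.rank T := by
  obtain ⟨I, hIS, hI, hIr⟩ := M.exists_indep_card_eq_rank (S ∩ T)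
  obtain ⟨J, hIJ, hJS, hJ, hJr⟩ := M.exists_superset_card_eq_rank hI
    (hIS.trans (Finset.inter_subset_left.trans (Finset.subset_union_left (s₂ := T))))
  rw [← hIr, ← hJr]
  have hunion : J ∩ S ∪ J ∩ T = J := by
    rw [← Finset.inter_union_distrib_left, Finset.inter_eq_left.2 hJS]
  have hinter : I ⊆ J ∩ S ∩ (J ∩ T) := by
    rw [← Finset.inter_inter_distrib_left]
    exact Finset.subset_inter hIJ hIS
  calc J.card + I.card ≤ (J ∩ S ∪ J ∩ T).card + (J ∩ S ∩ (J ∩ T)).card := by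
        rw [hunion]
        gcongr
    _ = (J ∩ S).card + (J ∩ T).card := Finset.card_union_add_card_inter _ _
    _ ≤ M.rank S + M.rank T := add_le_add
        (M.card_le_rank (M.indep_subset hJ Finset.inter_subset_left) Finset.inter_subset_right)
        (M.card_le_rank (M.indep_subset hJ Finset.inter_subset_left) Finset.inter_subset_right)

/-- If `f` is a coverage function or a nonnegative linear combination of
matroid rank functions, then the level sums `f_i = ∑_{|S|=i} f S` form an
ultra log-concave sequence. -/
theorem stmt_2 {n : ℕ} (f : Finset (Fin n) → ℝ)
    (h : IsCoverageOn (Finset.univ : Finset (Fin n)) f ∨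
      ∃ (m : ℕ) (c : Fin m → ℝ) (M : Fin m → FinMatroid n),
        (∀ j, 0 ≤ c j) ∧ ∀ S, f S = ∑ j, c j * ((M j).rank S : ℝ)) :
    ∀ k : ℕ, 1 < k → k < n →
      (levelSum f (k - 1) / ((n + 1).choose (k - 1) : ℝ)) *
          (levelSum f (k + 1) / ((n + 1).choose (k + 1) : ℝ)) ≤
        (levelSum f k / ((n + 1).choose k : ℝ)) ^ 2 := by
  have hf : (∀ S, 0 ≤ f S) ∧ ∀ S T, f (S ∪ T) + f (S ∩ T) ≤ f S + f T := by
    rcases h with h | ⟨m, c, M, hc, hM⟩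
    · exact ⟨h.nonneg, h.union_add_inter_le⟩
    · refine ⟨fun S => ?_, fun S T => ?_⟩
      · rw [hM]
        exact Finset.sum_nonneg fun j _ => mul_nonneg (hc j) (Nat.cast_nonneg _)
      · simp only [hM, ← Finset.sum_add_distrib, ← mul_add]
        refine Finset.sum_le_sum fun j _ => mul_le_mul_of_nonneg_left ?_ (hc j)
        exact_mod_cast (M j).rank_union_add_rank_inter_le S T
  intro k hk hkn
  obtain ⟨m, rfl⟩ : ∃ m, k = m + 1 := ⟨k - 1, by omega⟩
  exact levelSum_ultra_log_concave hf.1 hf.2 hkn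
end

section
/- Let f : 2^{[n]} → ℝ_{≥0} be a strongly 2-coverage set function with f(∅) = 0, and for 0 ≤ k ≤ n let c_k = Σ_{S⊆[n], |S|=k} f(S). Then for every k with 1 < k < n, (c_k / C(n+1,k))² ≥ (c_{k−1} / C(n+1,k−1)) · (c_{k+1} / C(n+1,k+1)). -/
open MvPolynomial

open Matrix in
/-- Reversed Cauchy–Schwarz: a symmetric form with this property has at most one positive
eigenvalue. -/
def Matrix.IsLorentzian {ι : Type*} [Fintype ι] (A : Matrix ι ι ℝ) : Prop :=
  ∀ u v : ι → ℝ, 0 < u ⬝ᵥ A *ᵥ u → (u ⬝ᵥ A *ᵥ u) * (v ⬝ᵥ A *ᵥ v) ≤ (u ⬝ᵥ A *ᵥ v) ^ 2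

section Lorentzian

open Matrix

variable {ι : Type*} [Fintype ι]

theorem Matrix.IsSymm.dotProduct_mulVec_comm {A : Matrix ι ι ℝ} (hA : A.IsSymm) (u v : ι → ℝ) :
    u ⬝ᵥ A *ᵥ v = v ⬝ᵥ A *ᵥ u := by
  rw [dotProduct_mulVec, ← mulVec_transpose, hA.eq, dotProduct_comm]

/-- A symmetric form that is nonpositive on a hyperplane is Lorentzian. -/
theorem Matrix.IsSymm.isLorentzian_of_nonpos_on_hyperplane {A : Matrix ι ι ℝ} (hA : A.IsSymm)
    (l : ι → ℝ) (h : ∀ v, l ⬝ᵥ v = 0 → v ⬝ᵥ A *ᵥ v ≤ 0) : A.IsLorentzian := by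
  intro u v hu
  have hlu : l ⬝ᵥ u ≠ 0 := fun h0 => absurd (h u h0) (not_le.2 hu)
  have key := h ((l ⬝ᵥ u) • v - (l ⬝ᵥ v) • u) (by
    simp only [dotProduct_sub, dotProduct_smul, smul_eq_mul]; ring)
  have hc := hA.dotProduct_mulVec_comm v u
  simp only [mulVec_sub, mulVec_smul, dotProduct_sub, sub_dotProduct, dotProduct_smul,
    smul_dotProduct, smul_eq_mul, hc] at key
  set a := u ⬝ᵥ A *ᵥ u
  set b := u ⬝ᵥ A *ᵥ v
  set c := v ⬝ᵥ A *ᵥ v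
  set p := l ⬝ᵥ u
  set q := l ⬝ᵥ v
  have hp : 0 < p ^ 2 := by positivity
  have h1 : p ^ 2 * (a * c) ≤ p ^ 2 * b ^ 2 := by
    nlinarith [sq_nonneg (p * b - q * a), mul_nonneg hu.le (neg_nonneg.2 key)]
  exact le_of_mul_le_mul_left h1 hp

variable [DecidableEq ι]

/-- If `x` is orthogonal to all eigenvectors with positive eigenvalue, then the form is
nonpositive at `x`. -/
theorem Matrix.IsHermitian.dotProduct_mulVec_nonpos {N : Matrix ι ι ℝ} (hN : N.IsHermitian)
    (x : ι → ℝ) (h : ∀ (c : ℝ) (v : ι → ℝ), N *ᵥ v = c • v → c ≤ 0 ∨ v ⬝ᵥ x = 0) :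
    x ⬝ᵥ N *ᵥ x ≤ 0 := by
  have hx : x = ∑ i, (hN.eigenvectorBasis i ⬝ᵥ x) • (hN.eigenvectorBasis i : ι → ℝ) := by
    have := congrArg WithLp.ofLp (hN.eigenvectorBasis.sum_repr' (WithLp.toLp 2 x))
    simpa [EuclideanSpace.inner_eq_star_dotProduct, dotProduct_comm] using this.symm
  have hNx : N *ᵥ x = ∑ i, (hN.eigenvectorBasis i ⬝ᵥ x) •
      hN.eigenvalues i • (hN.eigenvectorBasis i : ι → ℝ) := by
    conv_lhs => rw [hx, mulVec_sum]
    simp_rw [mulVec_smul, hN.mulVec_eigenvectorBasis]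
  rw [hNx, dotProduct_sum]
  refine Finset.sum_nonpos fun i _ => ?_
  rw [dotProduct_smul, dotProduct_smul, dotProduct_comm x, smul_eq_mul, smul_eq_mul]
  rcases h _ _ (hN.mulVec_eigenvectorBasis i) with h0 | h0
  · nlinarith [mul_nonneg (neg_nonneg.2 h0) (sq_nonneg (hN.eigenvectorBasis i ⬝ᵥ x))]
  · simp [h0]

/-- Version of `Matrix.IsHermitian.dotProduct_mulVec_nonpos` for the inner product with
weights `d`. -/
theorem Matrix.IsSymm.dotProduct_mulVec_nonpos_of_weights {B : Matrix ι ι ℝ} (hB : B.IsSymm)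
    {d : ι → ℝ} (hd : ∀ a, 0 < d a) (x : ι → ℝ)
    (h : ∀ (c : ℝ) (z : ι → ℝ), (∀ a, (B *ᵥ z) a = c * (d a * z a)) →
      c ≤ 0 ∨ ∑ a, d a * z a * x a = 0) :
    x ⬝ᵥ B *ᵥ x ≤ 0 := by
  set r : ι → ℝ := fun a => √(d a)
  have hr : ∀ a, 0 < r a := fun a => Real.sqrt_pos.2 (hd a)
  have hrr : ∀ a, r a * r a = d a := fun a => Real.mul_self_sqrt (hd a).le
  set N : Matrix ι ι ℝ := Matrix.of fun a b => B a b / (r a * r b) with hNdef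
  have hN : N.IsHermitian := by
    ext a b
    simp [hNdef, hB.apply a b, mul_comm (r a)]
  have hmul : ∀ v a, (N *ᵥ v) a = (B *ᵥ fun b => v b / r b) a / r a := by
    intro v a
    simp only [mulVec, dotProduct, hNdef, Matrix.of_apply, Finset.sum_div]
    refine Finset.sum_congr rfl fun b _ => ?_
    have := (hr a).ne'
    have := (hr b).ne'
    field_simp
  have key := hN.dotProduct_mulVec_nonpos (fun a => r a * x a) (by
    intro c v hv
    rcases h c (fun a => v a / r a) (by
      intro a
      have h1 := congrFun hv a
      rw [hmul, div_eq_iff (hr a).ne', Pi.smul_apply, smul_eq_mul] at h1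
      rw [h1, ← hrr a]
      have := (hr a).ne'
      field_simp) with h0 | h0
    · exact Or.inl h0
    · right
      rw [← h0]
      refine Finset.sum_congr rfl fun a _ => ?_
      rw [← hrr a]
      have := (hr a).ne'
      field_simp)
  convert key using 1
  refine Finset.sum_congr rfl fun a _ => ?_
  have h1 : (fun b => r b * x b / r b) = x := by
    funext b
    exact mul_div_cancel_left₀ _ (hr b).ne'
  rw [hmul, h1]
  have := (hr a).ne'
  field_simp

/-- A local-to-global principle: `B = ∑ w c • P c` is Lorentzian when all
slices `P c` of the symmetric tensor `P` are. -/
theorem isLorentzian_of_slices {P : ι → Matrix ι ι ℝ} (hP : ∀ a b c, P a b c = P b a c)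
    (hP' : ∀ a, (P a).IsSymm) (hyp : ∀ a, (P a).IsLorentzian) {w : ι → ℝ} (hw : ∀ a, 0 < w a)
    {B : Matrix ι ι ℝ} (hB : ∀ a b, B a b = ∑ c, w c * P c a b) (hB0 : ∀ a b, 0 ≤ B a b)
    (o : ι) (ho : ∀ a, 0 < B a o ∨ P a = 0) : B.IsLorentzian := by
  have hslice : ∀ v a, (B *ᵥ v) a = w ⬝ᵥ P a *ᵥ v := by
    intro v a
    simp only [mulVec, dotProduct, hB, Finset.sum_mul, Finset.mul_sum]
    rw [Finset.sum_comm]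
    refine Finset.sum_congr rfl fun c _ => Finset.sum_congr rfl fun b _ => ?_
    rw [hP a c b]; ring
  have hBsymm : B.IsSymm := by
    ext a b
    rw [transpose_apply, hB, hB]
    exact Finset.sum_congr rfl fun c _ => by rw [(hP' c).apply]
  have hquad : ∀ v, v ⬝ᵥ B *ᵥ v = ∑ c, w c * (v ⬝ᵥ P c *ᵥ v) := by
    intro v
    have hBP : B = ∑ c, w c • P c := by
      ext a b
      simp [Matrix.sum_apply, hB]
    rw [hBP, sum_mulVec, dotProduct_sum]
    simp_rw [smul_mulVec, dotProduct_smul, smul_eq_mul]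
  have hzero : ∀ a, P a = 0 → ∀ v, (B *ᵥ v) a = 0 := by
    intro a ha v
    rw [hslice, ha]; simp
  have hpos : ∀ a, P a ≠ 0 → 0 < (B *ᵥ w) a := by
    intro a ha
    refine Finset.sum_pos' (fun b _ => mul_nonneg (hB0 a b) (hw b).le)
      ⟨o, Finset.mem_univ _, mul_pos ((ho a).resolve_right ha) (hw o)⟩
  classical
  set d : ι → ℝ := fun a => if P a = 0 then 1 else (B *ᵥ w) a / w a with hd_def
  have hd : ∀ a, 0 < d a := by
    intro a
    simp only [hd_def]
    split_ifs with h
    · exact one_pos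
    · exact div_pos (hpos a h) (hw a)
  have hdw : ∀ a, P a ≠ 0 → d a * w a = (B *ᵥ w) a := by
    intro a ha
    simp only [hd_def, if_neg ha]
    exact div_mul_cancel₀ _ (hw a).ne'
  have hineq : ∀ v, v ⬝ᵥ B *ᵥ v ≤ ∑ a, (B *ᵥ v) a ^ 2 / d a := by
    intro v
    rw [hquad]
    refine Finset.sum_le_sum fun a _ => ?_
    by_cases ha : P a = 0
    · simp [ha, hzero a ha v]
    · have h1 := hyp a w v (by rw [← hslice]; exact hpos a ha)
      rw [← hslice, ← hslice, ← hdw a ha] at h1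
      rw [le_div_iff₀ (hd a)]
      nlinarith [h1]
  refine hBsymm.isLorentzian_of_nonpos_on_hyperplane (B *ᵥ w) fun x hx => ?_
  refine hBsymm.dotProduct_mulVec_nonpos_of_weights hd x fun c z hz => ?_
  rcases le_or_gt c 0 with hc | hc
  · exact Or.inl hc
  right
  have hz0 : ∀ a, P a = 0 → z a = 0 := by
    intro a ha
    have := hz a
    rw [hzero a ha] at this
    have h2 := mul_ne_zero hc.ne' (hd a).ne'
    rw [← mul_assoc] at this
    exact (mul_eq_zero.1 this.symm).resolve_left h2
  have hzz : z ⬝ᵥ B *ᵥ z = c * ∑ a, d a * z a ^ 2 := by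
    simp only [dotProduct, hz, Finset.mul_sum]
    exact Finset.sum_congr rfl fun a _ => by ring
  have hnn : 0 ≤ ∑ a, d a * z a ^ 2 := Finset.sum_nonneg fun a _ =>
    mul_nonneg (hd a).le (sq_nonneg _)
  have hle : ∑ a, d a * z a ^ 2 ≤ c * ∑ a, d a * z a ^ 2 := by
    have h1 := hineq z
    have h2 : ∑ a, (B *ᵥ z) a ^ 2 / d a = c * (c * ∑ a, d a * z a ^ 2) := by
      simp only [hz, Finset.mul_sum]
      refine Finset.sum_congr rfl fun a _ => ?_
      have := (hd a).ne'
      field_simp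
    rw [hzz, h2] at h1
    exact le_of_mul_le_mul_left h1 hc
  set u : ι → ℝ := fun a => z a / w a with hu
  have hzu : ∀ a, z a = w a * u a := fun a => (mul_div_cancel₀ _ (hw a).ne').symm
  have hdir : ∑ a, ∑ b, B a b * w a * w b * (u a - u b) ^ 2 ≤ 0 := by
    have h1 : ∑ a, ∑ b, B a b * w a * w b * u a ^ 2 = ∑ a, d a * z a ^ 2 := by
      refine Finset.sum_congr rfl fun a _ => ?_
      by_cases ha : P a = 0
      · simp [hu, hz0 a ha]
      · rw [hzu a, mul_pow, pow_two (w a), ← mul_assoc, ← mul_assoc, hdw a ha]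
        simp only [mulVec, dotProduct, Finset.sum_mul]
        exact Finset.sum_congr rfl fun b _ => by ring
    have h2 : ∑ a, ∑ b, B a b * w a * w b * u b ^ 2 = ∑ a, d a * z a ^ 2 := by
      rw [Finset.sum_comm, ← h1]
      refine Finset.sum_congr rfl fun a _ => Finset.sum_congr rfl fun b _ => ?_
      rw [hBsymm.apply]; ring
    have h3 : ∑ a, ∑ b, B a b * w a * w b * (u a * u b) = c * ∑ a, d a * z a ^ 2 := by
      rw [← hzz]
      simp only [mulVec, dotProduct, Finset.mul_sum]
      refine Finset.sum_congr rfl fun a _ => Finset.sum_congr rfl fun b _ => ?_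
      rw [hzu a, hzu b]; ring
    have h4 : ∑ a, ∑ b, B a b * w a * w b * (u a - u b) ^ 2 =
        ∑ a, ∑ b, B a b * w a * w b * u a ^ 2 + ∑ a, ∑ b, B a b * w a * w b * u b ^ 2
          - 2 * ∑ a, ∑ b, B a b * w a * w b * (u a * u b) := by
      simp only [Finset.mul_sum, ← Finset.sum_add_distrib, ← Finset.sum_sub_distrib]
      exact Finset.sum_congr rfl fun a _ => Finset.sum_congr rfl fun b _ => by ring
    rw [h4, h1, h2, h3]
    linarith
  have hconst : ∀ a, P a ≠ 0 → u a = u o := by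
    intro a ha
    have hterm : ∀ a b, 0 ≤ B a b * w a * w b * (u a - u b) ^ 2 := fun a b =>
      mul_nonneg (mul_nonneg (mul_nonneg (hB0 a b) (hw a).le) (hw b).le) (sq_nonneg _)
    have h1 : B a o * w a * w o * (u a - u o) ^ 2 ≤ 0 :=
      ((Finset.single_le_sum (fun b _ => hterm a b) (Finset.mem_univ o)).trans
        (Finset.single_le_sum (f := fun a => ∑ b, B a b * w a * w b * (u a - u b) ^ 2)
          (fun a _ => Finset.sum_nonneg fun b _ => hterm a b) (Finset.mem_univ a))).trans hdir
    have h2 : 0 < B a o * w a * w o :=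
      mul_pos (mul_pos ((ho a).resolve_right ha) (hw a)) (hw o)
    have h3 : (u a - u o) ^ 2 = 0 := le_antisymm (by
      by_contra! h; exact absurd h1 (not_le.2 (mul_pos h2 h))) (sq_nonneg _)
    exact sub_eq_zero.1 (pow_eq_zero_iff two_ne_zero |>.1 h3)
  calc ∑ a, d a * z a * x a = u o * ((B *ᵥ w) ⬝ᵥ x) := by
        rw [dotProduct, Finset.mul_sum]
        refine Finset.sum_congr rfl fun a _ => ?_
        by_cases ha : P a = 0
        · simp [hz0 a ha, hzero a ha]
        · rw [hzu a, hconst a ha, ← hdw a ha]; ring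
    _ = 0 := by rw [hx, mul_zero]

end Lorentzian

section LocalForms

open Matrix

variable {n : ℕ}

/-- The variables differentiated by an index of the Hessian; `none` is the homogenizing
variable. -/
def indexVars : Option (Fin n) → Multiset (Fin n)
  | none => 0
  | some i => {i}

open Nat in
/-- For `p = ∑ S, F S * y ^ (n + 1 - |S|) * z ^ S`, this is the derivative of `p` of order `n + 1`,
taken along the variables in `s`, `c` times along the direction `∑ i, z i + e y`, and the
remaining times along `y`. -/
noncomputable def mixedDeriv (F : Finset (Fin n) → ℝ) (e : ℝ) : ℕ → Multiset (Fin n) → ℝ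
  | 0, s => if s.Nodup then ((n + 1 - s.card)! : ℝ) * F s.toFinset else 0
  | c + 1, s => e * mixedDeriv F e c s + ∑ i, mixedDeriv F e c (i ::ₘ s)

/-- The quadratic form of the second derivatives of the mixed derivative. -/
noncomputable def mixedHessian (F : Finset (Fin n) → ℝ) (e : ℝ) (c : ℕ) (s : Multiset (Fin n)) :
    Matrix (Option (Fin n)) (Option (Fin n)) ℝ :=
  Matrix.of fun a b => mixedDeriv F e c (indexVars a + (indexVars b + s))

variable {F : Finset (Fin n) → ℝ} {e : ℝ}

theorem mixedDeriv_eq_zero (c : ℕ) {s : Multiset (Fin n)} (hs : ¬ s.Nodup) :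
    mixedDeriv F e c s = 0 := by
  induction c generalizing s with
  | zero => simp [mixedDeriv, hs]
  | succ c ih =>
    have : ∀ i, mixedDeriv F e c (i ::ₘ s) = 0 := fun i =>
      ih fun h => hs (Multiset.nodup_cons.1 h).2
    simp [mixedDeriv, ih hs, this]

theorem mixedDeriv_nonneg (hF : ∀ S, 0 < F S) (he : 0 < e) (c : ℕ) (s : Multiset (Fin n)) :
    0 ≤ mixedDeriv F e c s := by
  induction c generalizing s with
  | zero =>
    rw [mixedDeriv]
    split_ifs
    · exact mul_nonneg (Nat.cast_nonneg _) (hF _).le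
    · exact le_rfl
  | succ c ih => exact add_nonneg (mul_nonneg he.le (ih s)) (Finset.sum_nonneg fun i _ => ih _)

theorem mixedDeriv_pos (hF : ∀ S, 0 < F S) (he : 0 < e) (c : ℕ) {s : Multiset (Fin n)}
    (hs : s.Nodup) : 0 < mixedDeriv F e c s := by
  induction c with
  | zero =>
    rw [mixedDeriv, if_pos hs]
    exact mul_pos (Nat.cast_pos.2 (Nat.factorial_pos _)) (hF _)
  | succ c ih =>
    exact add_pos_of_pos_of_nonneg (mul_pos he ih)
      (Finset.sum_nonneg fun i _ => mixedDeriv_nonneg hF he c _)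

theorem mixedHessian_isSymm (c : ℕ) (s : Multiset (Fin n)) : (mixedHessian F e c s).IsSymm := by
  ext a b
  simp only [transpose_apply, mixedHessian, of_apply]
  rw [add_left_comm]

theorem StronglyTwoCoverage.exists_gram (hF : StronglyTwoCoverage F) {τ : Finset (Fin n)}
    (hτ : τ.card ≤ n - 2) :
    ∃ (m : ℕ) (w : Fin m → ℝ) (χ : Fin n → Fin m → ℝ), (∀ u, 0 ≤ w u) ∧
      (∀ i u, χ i u * χ i u = χ i u) ∧ (∀ i u, 0 ≤ χ i u) ∧
      (∀ i, i ∉ τ → F (insert i τ) = F τ + ∑ u, w u * χ i u) ∧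
      ∀ i j, i ∉ τ → j ∉ τ → i ≠ j → F (insert i (insert j τ)) =
        F τ + ∑ u, w u * χ i u + ∑ u, w u * χ j u - ∑ u, w u * (χ i u * χ j u) := by
  obtain ⟨g, ⟨m, w, A, hw, hg⟩, hFg⟩ := hF τ hτ
  have hsum : ∀ U : Finset (Fin m), ∑ u ∈ U, w u = ∑ u, w u * (if u ∈ U then 1 else 0) := by
    intro U
    simp
  refine ⟨m, w, fun i u => if u ∈ A i then 1 else 0, hw, ?_, ?_, ?_, ?_⟩
  · intro i u
    by_cases h : u ∈ A i <;> simp [h]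
  · intro i u
    by_cases h : u ∈ A i <;> simp [h]
  · intro i hi
    have hsub : ({i} : Finset (Fin n)) ⊆ Finset.univ \ τ := by simpa using hi
    have h := hFg {i} hsub (by simp) (by simp)
    rw [hg _ hsub, Finset.singleton_biUnion, hsum] at h
    rw [← Finset.singleton_union, Finset.union_comm, h, add_comm]
  · intro i j hi hj hij
    have hsub : ({i, j} : Finset (Fin n)) ⊆ Finset.univ \ τ := by
      intro a ha
      rcases Finset.mem_insert.1 ha with rfl | ha
      · simpa using hi
      · rw [Finset.mem_singleton.1 ha]; simpa using hj
    have h := hFg {i, j} hsub (by simp) Finset.card_le_two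
    rw [hg _ hsub, Finset.biUnion_insert, Finset.singleton_biUnion, hsum] at h
    have hins : insert i (insert j τ) = τ ∪ {i, j} := by
      ext a; simp
    rw [hins, h, add_comm, add_assoc, add_sub_assoc, ← Finset.sum_add_distrib,
      ← Finset.sum_sub_distrib]
    congr 1
    refine Finset.sum_congr rfl fun u _ => ?_
    by_cases h1 : u ∈ A i <;> by_cases h2 : u ∈ A j <;> simp [h1, h2]

/-- The quadratic form of a homogenized coverage-type function is nonpositive on the hyperplane
`m * η + ∑ i, y i = 0`. -/
theorem coverage_form_nonpos {ι κ : Type*} [Fintype ι] [DecidableEq ι] [Fintype κ] {k : ℝ}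
    (hk : 0 ≤ k) {w : κ → ℝ} (hw : ∀ u, 0 ≤ w u) {χ : ι → κ → ℝ}
    (hχ : ∀ i u, χ i u * χ i u = χ i u) (hχ0 : ∀ i u, 0 ≤ χ i u) {m η : ℝ} (hm : 0 < m)
    {y : ι → ℝ} (hy : (∑ i, y i) ^ 2 ≤ m * ∑ i, y i ^ 2) (hη : m * η + ∑ i, y i = 0) :
    k * (m * (m + 1)) * η ^ 2 + 2 * m * η * ∑ i, (k + ∑ u, w u * χ i u) * y i +
      ∑ i, ∑ j, (if i = j then 0 else
        (k + ∑ u, w u * χ i u + ∑ u, w u * χ j u - ∑ u, w u * (χ i u * χ j u)) * (y i * y j))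
      ≤ 0 := by
  set D : ι → ℝ := fun i => ∑ u, w u * χ i u with hD
  set G : ι → ι → ℝ := fun i j => ∑ u, w u * (χ i u * χ j u) with hG
  have hGD : ∀ i, G i i = D i := fun i => by simp only [hG, hD, hχ]
  have hD0 : ∀ i, 0 ≤ D i := fun i => Finset.sum_nonneg fun u _ => mul_nonneg (hw u) (hχ0 i u)
  set s := ∑ i, y i with hs
  set t := ∑ i, D i * y i with ht
  have hGy : 0 ≤ ∑ i, ∑ j, G i j * (y i * y j) := by
    have : ∑ i, ∑ j, G i j * (y i * y j) = ∑ u, w u * (∑ i, χ i u * y i) ^ 2 := by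
      simp only [hG, pow_two, Finset.mul_sum, Finset.sum_mul]
      rw [Finset.sum_congr rfl fun i _ => Finset.sum_comm, Finset.sum_comm]
      refine Finset.sum_congr rfl fun u _ => Finset.sum_congr rfl fun i _ =>
        Finset.sum_congr rfl fun j _ => ?_
      ring
    rw [this]
    exact Finset.sum_nonneg fun u _ => mul_nonneg (hw u) (sq_nonneg _)
  have hlin : ∑ i, (k + D i) * y i = k * s + t := by
    simp only [add_mul, Finset.sum_add_distrib, ← Finset.mul_sum, hs, ht]
  have hdiag : 0 ≤ ∑ i, D i * y i ^ 2 :=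
    Finset.sum_nonneg fun i _ => mul_nonneg (hD0 i) (sq_nonneg _)
  have hfull : ∑ i, ∑ j, (k + D i + D j - G i j) * (y i * y j) =
      k * s ^ 2 + 2 * s * t - ∑ i, ∑ j, G i j * (y i * y j) := by
    have h1 : k * s ^ 2 = ∑ i, ∑ j, k * (y i * y j) := by
      rw [pow_two, hs, Finset.sum_mul_sum, Finset.mul_sum]
      simp only [Finset.mul_sum]
    have h2 : s * t = ∑ i, ∑ j, D j * (y i * y j) := by
      rw [hs, ht, Finset.sum_mul_sum]
      exact Finset.sum_congr rfl fun i _ => Finset.sum_congr rfl fun j _ => by ring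
    have h3 : t * s = ∑ i, ∑ j, D i * (y i * y j) := by
      rw [hs, ht, Finset.sum_mul_sum]
      exact Finset.sum_congr rfl fun i _ => Finset.sum_congr rfl fun j _ => by ring
    have h4 : k * s ^ 2 + 2 * s * t = k * s ^ 2 + t * s + s * t := by ring
    rw [h4, h1, h2, h3]
    simp only [← Finset.sum_add_distrib, ← Finset.sum_sub_distrib]
    exact Finset.sum_congr rfl fun i _ => Finset.sum_congr rfl fun j _ => by ring
  have hoff : ∑ i, ∑ j, (if i = j then 0 else (k + D i + D j - G i j) * (y i * y j)) =
      ∑ i, ∑ j, (k + D i + D j - G i j) * (y i * y j) -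
        (k * ∑ i, y i ^ 2 + ∑ i, D i * y i ^ 2) := by
    rw [Finset.mul_sum, ← Finset.sum_add_distrib, ← Finset.sum_sub_distrib]
    refine Finset.sum_congr rfl fun i _ => ?_
    have h1 : ∀ j, (if i = j then 0 else (k + D i + D j - G i j) * (y i * y j)) =
        (k + D i + D j - G i j) * (y i * y j) -
          if i = j then (k + D i + D j - G i j) * (y i * y j) else 0 := by
      intro j; split_ifs <;> simp
    simp only [h1, Finset.sum_sub_distrib, Finset.sum_ite_eq, Finset.mem_univ, if_true, hGD]
    ring
  rw [hlin, hoff, hfull]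
  have hsη : s = -(m * η) := by linarith
  rw [hsη] at hy ⊢
  have h5 : m * η ^ 2 ≤ ∑ i, y i ^ 2 := by
    refine le_of_mul_le_mul_left ?_ hm
    calc m * (m * η ^ 2) = (-(m * η)) ^ 2 := by ring
      _ ≤ _ := hy
  nlinarith [mul_le_mul_of_nonneg_left h5 hk]

theorem mixedHessian_quadratic_form (c : ℕ) (s : Multiset (Fin n)) (v : Option (Fin n) → ℝ) :
    v ⬝ᵥ mixedHessian F e c s *ᵥ v = mixedDeriv F e c s * v none ^ 2 +
      2 * v none * ∑ i, mixedDeriv F e c (i ::ₘ s) * v (some i) +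
      ∑ i, ∑ j, mixedDeriv F e c (i ::ₘ j ::ₘ s) * (v (some i) * v (some j)) := by
  have hterm : ∀ a b, v a * (mixedHessian F e c s a b * v b) =
      mixedDeriv F e c (indexVars a + (indexVars b + s)) * (v a * v b) := by
    intro a b
    rw [mixedHessian, of_apply]; ring
  have hsum : v ⬝ᵥ mixedHessian F e c s *ᵥ v =
      ∑ a, ∑ b, mixedDeriv F e c (indexVars a + (indexVars b + s)) * (v a * v b) := by
    simp only [dotProduct, mulVec, Finset.mul_sum, hterm]
  rw [hsum]
  simp only [Fintype.sum_option, Finset.mul_sum, Finset.sum_add_distrib, indexVars, zero_add,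
    Multiset.singleton_add]
  have h1 : ∑ i, mixedDeriv F e c (i ::ₘ s) * (v (some i) * v none) =
      ∑ i, mixedDeriv F e c (i ::ₘ s) * (v none * v (some i)) :=
    Finset.sum_congr rfl fun i _ => by ring
  have h2 : ∑ i, 2 * v none * (mixedDeriv F e c (i ::ₘ s) * v (some i)) =
      2 * ∑ i, mixedDeriv F e c (i ::ₘ s) * (v none * v (some i)) := by
    rw [Finset.mul_sum]
    exact Finset.sum_congr rfl fun i _ => by ring
  rw [h1, h2]
  ring

theorem mixedHessian_zero_isLorentzian (hF : ∀ S, 0 < F S) (hcov : StronglyTwoCoverage F)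
    {s : Multiset (Fin n)} (hs : s.Nodup) (hsn : s.card + 1 ≤ n) :
    (mixedHessian F e 0 s).IsLorentzian := by
  have hcard : ∀ {t : Multiset (Fin n)}, t.Nodup → t.card ≤ n := by
    intro t ht
    simpa [Multiset.toFinset_card_of_nodup ht] using Finset.card_le_univ t.toFinset
  rcases hsn.eq_or_lt with hsn | hsn
  · refine (mixedHessian_isSymm 0 s).isLorentzian_of_nonpos_on_hyperplane (Pi.single none 1)
      fun v hv => ?_
    have hv0 : v none = 0 := by simpa using hv
    have hz : ∀ i j, mixedDeriv F e 0 (i ::ₘ j ::ₘ s) = 0 := fun i j =>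
      mixedDeriv_eq_zero 0 fun h => by
        have := hcard h
        simp only [Multiset.card_cons] at this
        omega
    simp [mixedHessian_quadratic_form, hv0, hz]
  · obtain ⟨r, hr⟩ := Nat.exists_eq_add_of_le hsn
    set τ := s.toFinset with hτ
    have hτs : τ.card = s.card := Multiset.toFinset_card_of_nodup hs
    have hmem : ∀ i, i ∈ τ ↔ i ∈ s := fun i => Multiset.mem_toFinset
    obtain ⟨m, w, χ, hw, hχ, hχ0, h1, h2⟩ := hcov.exists_gram (τ := τ) (by omega)
    set q : ℝ := (r : ℝ) + 2 with hq
    refine (mixedHessian_isSymm 0 s).isLorentzian_of_nonpos_on_hyperplane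
      (fun a => a.elim q fun i => if i ∈ τ then 0 else 1) fun v hv => ?_
    set y : Fin n → ℝ := fun i => if i ∈ τ then 0 else v (some i) with hy
    have hv' : q * v none + ∑ i, y i = 0 := by
      simpa [dotProduct, Fintype.sum_option, hy] using hv
    have hcs : (∑ i, y i) ^ 2 ≤ q * ∑ i, y i ^ 2 := by
      have hsub : ∀ g : Fin n → ℝ, (∀ i ∈ τ, g i = 0) → ∑ i ∈ τᶜ, g i = ∑ i, g i := by
        intro g hg
        refine Finset.sum_subset (Finset.subset_univ _) fun i _ hi => hg i ?_
        simpa using hi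
      have h3 := sq_sum_le_card_mul_sum_sq (s := τᶜ) (f := y)
      have h4 : ((τᶜ.card : ℕ) : ℝ) = q := by
        have : τᶜ.card = r + 2 := by
          rw [Finset.card_compl, Fintype.card_fin, hτs]; omega
        rw [this, hq]; push_cast; ring
      rwa [hsub y fun i hi => by simp [hy, hi], hsub (fun i => y i ^ 2)
        fun i hi => by simp [hy, hi], h4] at h3
    have key := coverage_form_nonpos (hF τ).le hw hχ hχ0 (by positivity) hcs hv'
    set p : ℝ := ((r + 1).factorial : ℝ) with hp
    have hp0 : 0 ≤ p := Nat.cast_nonneg _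
    have e0 : mixedDeriv F e 0 s = p * (F τ * (q * (q + 1))) := by
      have : n + 1 - s.card = r + 3 := by omega
      rw [mixedDeriv, if_pos hs, this, Nat.factorial_succ, Nat.factorial_succ (r + 1), hp, hq]
      push_cast; ring
    have e1 : ∀ i, mixedDeriv F e 0 (i ::ₘ s) * v (some i) =
        p * (q * ((F τ + ∑ u, w u * χ i u) * y i)) := by
      intro i
      by_cases hi : i ∈ τ
      · rw [mixedDeriv_eq_zero 0 fun h => (Multiset.nodup_cons.1 h).1 ((hmem i).1 hi)]
        simp [hy, hi]
      · have hnd : (i ::ₘ s).Nodup := Multiset.nodup_cons.2 ⟨fun h => hi ((hmem i).2 h), hs⟩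
        have : n + 1 - (i ::ₘ s).card = r + 2 := by rw [Multiset.card_cons]; omega
        rw [mixedDeriv, if_pos hnd, this, Nat.factorial_succ (r + 1), Multiset.toFinset_cons,
          h1 i hi]
        simp only [hy, if_neg hi, hp, hq]
        push_cast; ring
    have e2 : ∀ i j, mixedDeriv F e 0 (i ::ₘ j ::ₘ s) * (v (some i) * v (some j)) =
        p * (if i = j then 0 else (F τ + ∑ u, w u * χ i u + ∑ u, w u * χ j u -
          ∑ u, w u * (χ i u * χ j u)) * (y i * y j)) := by
      intro i j
      by_cases hnd : (i ::ₘ j ::ₘ s).Nodup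
      · obtain ⟨hi, hj⟩ := Multiset.nodup_cons.1 hnd
        rw [Multiset.mem_cons, not_or, ← hmem] at hi
        have hj' := (Multiset.nodup_cons.1 hj).1
        rw [← hmem] at hj'
        have : n + 1 - (i ::ₘ j ::ₘ s).card = r + 1 := by simp only [Multiset.card_cons]; omega
        rw [mixedDeriv, if_pos hnd, this, Multiset.toFinset_cons, Multiset.toFinset_cons,
          h2 i j hi.2 hj' hi.1, if_neg hi.1]
        simp only [hy, if_neg hi.2, if_neg hj']
        ring
      · rw [mixedDeriv_eq_zero 0 hnd, zero_mul]
        rw [Multiset.nodup_cons, Multiset.nodup_cons, Multiset.mem_cons, ← hmem, ← hmem] at hnd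
        by_cases hij : i = j
        · simp [hij]
        · have : i ∈ τ ∨ j ∈ τ := by tauto
          rcases this with h | h <;> simp [hy, h]
    rw [mixedHessian_quadratic_form, e0]
    simp only [e1, e2, ← Finset.mul_sum]
    have := mul_nonpos_of_nonneg_of_nonpos hp0 key
    linarith

theorem mixedHessian_isLorentzian (hF : ∀ S, 0 < F S) (hcov : StronglyTwoCoverage F) (he : 0 < e)
    (c : ℕ) {s : Multiset (Fin n)} (hs : s.Nodup) (hsn : s.card + c + 1 ≤ n) :
    (mixedHessian F e c s).IsLorentzian := by
  induction c generalizing s with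
  | zero => exact mixedHessian_zero_isLorentzian hF hcov hs hsn
  | succ c ih =>
    have hzero : ∀ i ∈ s, mixedHessian F e c (indexVars (some i) + s) = 0 := by
      intro i hi
      ext a b
      refine mixedDeriv_eq_zero c fun h => ?_
      have h1 := Multiset.nodup_of_le (Multiset.le_add_left _ _)
        (Multiset.nodup_of_le (Multiset.le_add_left _ _) h)
      exact (Multiset.nodup_cons.1 (by simpa [indexVars] using h1)).1 hi
    refine isLorentzian_of_slices (P := fun a => mixedHessian F e c (indexVars a + s))
      (w := fun a => a.elim e fun _ => 1) ?_ ?_ ?_ ?_ ?_ ?_ none ?_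
    · intro a b d
      simp only [mixedHessian, of_apply]
      congr 1
      ac_rfl
    · exact fun a => mixedHessian_isSymm c _
    · rintro (_ | i)
      · exact ih (by simpa [indexVars] using hs) (by simp [indexVars]; omega)
      · by_cases hi : i ∈ s
        · simp only [hzero i hi]
          intro u v hu
          simp at hu
        · exact ih (by simpa [indexVars] using ⟨hi, hs⟩) (by simp [indexVars]; omega)
    · rintro (_ | i)
      · exact he
      · exact one_pos
    · intro a b
      simp only [mixedHessian, of_apply, mixedDeriv, Fintype.sum_option, Option.elim, indexVars,
        zero_add, one_mul]
      congr 1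
      refine Finset.sum_congr rfl fun i _ => ?_
      congr 1
      rw [← Multiset.singleton_add]
      ac_rfl
    · exact fun a b => mixedDeriv_nonneg hF he _ _
    · rintro (_ | i)
      · exact Or.inl (mixedDeriv_pos hF he _ (by simpa [indexVars] using hs))
      · by_cases hi : i ∈ s
        · exact Or.inr (hzero i hi)
        · exact Or.inl (mixedDeriv_pos hF he _ (by simpa [indexVars] using ⟨hi, hs⟩))

theorem mixedDeriv_logConcave (hF : ∀ S, 0 < F S) (hcov : StronglyTwoCoverage F) (he : 0 < e)
    {c : ℕ} (hc : c + 1 ≤ n) :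
    mixedDeriv F e c 0 * mixedDeriv F e (c + 2) 0 ≤ mixedDeriv F e (c + 1) 0 ^ 2 := by
  have hL := mixedHessian_isLorentzian hF hcov he c (s := 0) (by simp) (by simpa using hc)
  set w : Option (Fin n) → ℝ := fun a => a.elim e fun _ => 1 with hw
  have h1 : Pi.single none 1 ⬝ᵥ mixedHessian F e c 0 *ᵥ Pi.single none 1 =
      mixedDeriv F e c 0 := by
    simp [mixedHessian, indexVars]
  have h2 : Pi.single none 1 ⬝ᵥ mixedHessian F e c 0 *ᵥ w = mixedDeriv F e (c + 1) 0 := by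
    simp [mixedHessian, indexVars, mulVec, dotProduct, Fintype.sum_option, hw, mixedDeriv,
      mul_comm]
  have h3 : w ⬝ᵥ mixedHessian F e c 0 *ᵥ w = mixedDeriv F e (c + 2) 0 := by
    rw [mixedHessian_quadratic_form]
    simp only [hw, Option.elim, mixedDeriv, mul_one, Finset.sum_add_distrib, ← Finset.mul_sum]
    rw [Finset.sum_comm]
    ring
  have := hL (Pi.single none 1) w (by rw [h1]; exact mixedDeriv_pos hF he c (by simp))
  rwa [h1, h2, h3] at this

theorem continuous_mixedDeriv (f : Finset (Fin n) → ℝ) (c : ℕ) (s : Multiset (Fin n)) :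
    Continuous fun e : ℝ => mixedDeriv (fun S => f S + e) e c s := by
  induction c generalizing s with
  | zero =>
    simp only [mixedDeriv]
    split_ifs <;> fun_prop
  | succ c ih =>
    simp only [mixedDeriv]
    exact (continuous_id.mul (ih s)).add (continuous_finsetSum _ fun i _ => ih _)

open Nat in
theorem mixedDeriv_zero_weight (f : Finset (Fin n) → ℝ) (c : ℕ) (τ : Finset (Fin n)) :
    mixedDeriv f 0 c τ.val = (c ! : ℝ) * ((n + 1 - (τ.card + c))! : ℝ) *
      ∑ S ∈ Finset.powersetCard (τ.card + c) Finset.univ, if τ ⊆ S then f S else 0 := by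
  induction c generalizing τ with
  | zero =>
    have : ∑ S ∈ Finset.powersetCard τ.card Finset.univ, (if τ ⊆ S then f S else 0) = f τ := by
      rw [Finset.sum_eq_single τ]
      · simp
      · intro S hS hne
        refine if_neg fun hsub => hne ?_
        exact (Finset.eq_of_subset_of_card_le hsub (Finset.mem_powersetCard.1 hS).2.le).symm
      · intro h
        exact absurd (Finset.mem_powersetCard.2 ⟨Finset.subset_univ _, rfl⟩) h
    simp [mixedDeriv, τ.nodup, this]
  | succ c ih =>
    have hstep : ∀ i, mixedDeriv f 0 c (i ::ₘ τ.val) =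
        (c ! : ℝ) * ((n + 1 - (τ.card + (c + 1)))! : ℝ) *
          ∑ S ∈ Finset.powersetCard (τ.card + (c + 1)) Finset.univ,
            if τ ⊆ S then (if i ∈ S \ τ then f S else 0) else 0 := by
      intro i
      by_cases hi : i ∈ τ
      · rw [mixedDeriv_eq_zero c fun h => (Multiset.nodup_cons.1 h).1 hi]
        simp [hi]
      · have h := ih (Finset.cons i τ hi)
        rw [Finset.cons_val, Finset.card_cons, add_assoc, add_comm 1 c] at h
        rw [h]
        congr 1
        refine Finset.sum_congr rfl fun S _ => ?_
        simp only [Finset.cons_eq_insert, Finset.insert_subset_iff, Finset.mem_sdiff, hi]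
        by_cases h1 : i ∈ S <;> by_cases h2 : τ ⊆ S <;> simp [h1, h2]
    rw [mixedDeriv, zero_mul, zero_add]
    simp only [hstep, ← Finset.mul_sum]
    rw [Finset.sum_comm]
    have hcount : ∑ S ∈ Finset.powersetCard (τ.card + (c + 1)) Finset.univ,
        ∑ i, (if τ ⊆ S then (if i ∈ S \ τ then f S else 0) else 0) = ((c : ℝ) + 1) *
          ∑ S ∈ Finset.powersetCard (τ.card + (c + 1)) Finset.univ, if τ ⊆ S then f S else 0 := by
      rw [Finset.mul_sum]
      refine Finset.sum_congr rfl fun S hS => ?_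
      by_cases h2 : τ ⊆ S
      · have h3 : (S \ τ).card = c + 1 := by
          rw [Finset.card_sdiff_of_subset h2, (Finset.mem_powersetCard.1 hS).2]; omega
        simp only [if_pos h2]
        rw [Finset.sum_ite_mem, Finset.univ_inter, Finset.sum_const, h3, nsmul_eq_mul]
        push_cast; ring
      · simp [h2]
    rw [hcount, Nat.factorial_succ c]
    push_cast; ring

open Nat in
theorem mixedDeriv_empty (f : Finset (Fin n) → ℝ) {c : ℕ} (hc : c ≤ n + 1) :
    mixedDeriv f 0 c 0 = ((n + 1)! : ℝ) * (levelSum f c / ((n + 1).choose c : ℝ)) := by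
  have h := mixedDeriv_zero_weight f c ∅
  simp only [Finset.empty_val, Finset.card_empty, zero_add, Finset.empty_subset, if_true] at h
  have h1 : ((n + 1).choose c : ℝ) ≠ 0 := Nat.cast_ne_zero.2 (Nat.choose_pos hc).ne'
  rw [h, ← Nat.choose_mul_factorial_mul_factorial hc, levelSum]
  push_cast
  field_simp

theorem StronglyTwoCoverage.add_const {f : Finset (Fin n) → ℝ} (hf : StronglyTwoCoverage f)
    (e : ℝ) : StronglyTwoCoverage fun S => f S + e := by
  intro τ hτ
  obtain ⟨g, hg, h⟩ := hf τ hτ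
  refine ⟨g, hg, fun S h1 h2 h3 => ?_⟩
  simp only [h S h1 h2 h3]
  ring

end LocalForms

/-- For a strongly 2-coverage `f` with `f ∅ = 0`, the level sums
`c_k = ∑_{|S|=k} f S` form an ultra log-concave sequence. -/
theorem stmt_3 {n : ℕ} (f : Finset (Fin n) → ℝ) (hf : ∀ S, 0 ≤ f S) (hf0 : f ∅ = 0)
    (hcov : StronglyTwoCoverage f) :
    ∀ k : ℕ, 1 < k → k < n →
      (levelSum f (k - 1) / ((n + 1).choose (k - 1) : ℝ)) *
          (levelSum f (k + 1) / ((n + 1).choose (k + 1) : ℝ)) ≤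
        (levelSum f k / ((n + 1).choose k : ℝ)) ^ 2 := by
  intro k hk hkn
  obtain ⟨c, rfl⟩ : ∃ c, k = c + 1 := ⟨k - 1, by omega⟩
  have hlim : mixedDeriv f 0 c 0 * mixedDeriv f 0 (c + 2) 0 ≤ mixedDeriv f 0 (c + 1) 0 ^ 2 := by
    have hT : ∀ j, Filter.Tendsto (fun e : ℝ => mixedDeriv (fun S => f S + e) e j 0)
        (nhdsWithin 0 (Set.Ioi 0)) (nhds (mixedDeriv f 0 j 0)) := fun j => by
      simpa using ((continuous_mixedDeriv f j 0).tendsto 0).mono_left nhdsWithin_le_nhds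
    refine le_of_tendsto_of_tendsto ((hT c).mul (hT (c + 2))) ((hT (c + 1)).pow 2) ?_
    filter_upwards [self_mem_nhdsWithin] with e he
    exact mixedDeriv_logConcave (fun S => add_pos_of_nonneg_of_pos (hf S) he)
      (hcov.add_const e) he (by omega)
  rw [mixedDeriv_empty f (by omega), mixedDeriv_empty f (by omega),
    mixedDeriv_empty f (by omega)] at hlim
  rw [Nat.add_sub_cancel]
  have hpos : (0 : ℝ) < ((n + 1).factorial : ℝ) ^ 2 := by positivity
  refine le_of_mul_le_mul_left ?_ hpos
  linarith
end

section
/- Let g : 2^{[n]} → ℝ_{≥0} be a coverage function, let D ∈ ℝ^{n×n} be the diagonal matrix with D(i,i) = g({i}) for all i ∈ [n], let J be the n×n all-ones matrix, and let H ∈ ℝ^{n×n} be the symmetric matrix with H(i,j) = g({i,j}) for i ≠ j and H(i,i) = 0 (the Hessian of the generating polynomial of the 2-homogeneous restriction g^{(2)}). Then DJ + JD − H ⪰ D, i.e., DJ + JD − H − D is positive semidefinite. -/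
open MvPolynomial

/-- The Gram matrix of weighted intersections of finitely many finite sets is positive
semidefinite. -/
theorem posSemidef_of_sum_inter {ι α : Type*} [Finite ι] [DecidableEq α] [Fintype α]
    (w : α → ℝ) (hw : ∀ u, 0 ≤ w u) (A : ι → Finset α) :
    (Matrix.of fun i j => ∑ u ∈ A i ∩ A j, w u).PosSemidef := by
  have h : (Matrix.of fun i j => ∑ u ∈ A i ∩ A j, w u) =
      ∑ u, w u • Matrix.vecMulVec (fun i => if u ∈ A i then (1 : ℝ) else 0)
        (star fun i => if u ∈ A i then (1 : ℝ) else 0) := by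
    ext i j
    have hij : A i ∩ A j = Finset.univ.filter fun u => u ∈ A i ∧ u ∈ A j := by ext; simp
    rw [Matrix.sum_apply, Matrix.of_apply, hij, Finset.sum_filter]
    refine Finset.sum_congr rfl fun u _ => ?_
    by_cases hi : u ∈ A i <;> by_cases hj : u ∈ A j <;> simp [Matrix.vecMulVec_apply, hi, hj]
  rw [h]
  exact Matrix.posSemidef_sum _ fun u _ =>
    (Matrix.posSemidef_vecMulVec_self_star _).smul (hw u)

/-- For a coverage function `g`, with `D = diag(g {i})`, `J` the all-ones
matrix and `H` the Hessian of the generating polynomial of `g^{(2)}`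
(`H i j = g {i, j}` off the diagonal, `0` on it), we have `D*J + J*D - H ⪰ D`. -/
theorem stmt_5 {n : ℕ} (g : Finset (Fin n) → ℝ)
    (hg : IsCoverageOn (Finset.univ : Finset (Fin n)) g) :
    (Matrix.diagonal (fun i => g {i}) * Matrix.of (fun _ _ => (1 : ℝ)) +
        Matrix.of (fun _ _ => (1 : ℝ)) * Matrix.diagonal (fun i => g {i}) -
        Matrix.of (fun i j : Fin n => if i = j then 0 else g {i, j}) -
        Matrix.diagonal (fun i => g {i})).PosSemidef := by
  obtain ⟨m, w, A, hw, hA⟩ := hg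
  convert posSemidef_of_sum_inter w hw A using 1
  ext i j
  simp only [Matrix.sub_apply, Matrix.add_apply, Matrix.diagonal_mul, Matrix.mul_diagonal,
    Matrix.of_apply, mul_one, one_mul, hA _ (Finset.subset_univ _), Finset.singleton_biUnion]
  by_cases hij : i = j
  · subst hij
    simp
  · rw [if_neg hij, Matrix.diagonal_apply_ne _ hij, Finset.biUnion_insert,
      Finset.singleton_biUnion]
    linarith [Finset.sum_union_inter (s₁ := A i) (s₂ := A j) (f := w)]
end

section
/- Let f : 2^{[n]} → ℝ_{≥0} be a set function whose generating polynomial p_f is log-concave over ℝ^n_{≥0}. Then f is almost log-submodular: for every S ⊆ [n] and distinct i, j ∈ [n] ∖ S, 2 · f(S ∪ {i}) · f(S ∪ {j}) ≥ f(S) · f(S ∪ {i, j}). -/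
open MvPolynomial

open Filter Topology

theorem eval_genPoly {n : ℕ} (f : Finset (Fin n) → ℝ) (x : Fin n → ℝ) :
    MvPolynomial.eval x (genPoly f) = ∑ T : Finset (Fin n), f T * ∏ k ∈ T, x k := by
  simp [genPoly]

theorem LogConcaveOn.midpoint {n : ℕ} {p : MvPolynomial (Fin n) ℝ} (h : LogConcaveOn p)
    {x y : Fin n → ℝ} (hx : ∀ i, 0 ≤ x i) (hy : ∀ i, 0 ≤ y i) :
    MvPolynomial.eval x p * MvPolynomial.eval y p ≤
      MvPolynomial.eval (fun i => (x i + y i) / 2) p ^ 2 := by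
  have h1 := h.2 x y hx hy (1 / 2) (by norm_num) (by norm_num)
  have e : (fun i => 1 / 2 * x i + (1 - 1 / 2) * y i) = fun i => (x i + y i) / 2 := by
    funext i; ring
  rw [e, show (1 : ℝ) - 1 / 2 = 1 / 2 by norm_num, ← Real.sqrt_eq_rpow, ← Real.sqrt_eq_rpow] at h1
  have h2 := pow_le_pow_left₀ (by positivity) h1 2
  rwa [mul_pow, Real.sq_sqrt (h.1 x hx), Real.sq_sqrt (h.1 y hy)] at h2

/-- The value at `w` of the partial derivative `∏ i ∈ S, ∂_{z i}` of `genPoly f`. -/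
noncomputable def linkEval {n : ℕ} (f : Finset (Fin n) → ℝ) (S : Finset (Fin n))
    (w : Fin n → ℝ) : ℝ :=
  ∑ T : Finset (Fin n), f T * if S ⊆ T then ∏ k ∈ T \ S, w k else 0

theorem tendsto_eval_linkEval {n : ℕ} (f : Finset (Fin n) → ℝ) (S : Finset (Fin n))
    (w : Fin n → ℝ) :
    Tendsto (fun ε : ℝ => ε ^ S.card *
      MvPolynomial.eval (fun k => if k ∈ S then ε⁻¹ else w k) (genPoly f))
      (𝓝[>] 0) (𝓝 (linkEval f S w)) := by
  have key : ∀ T : Finset (Fin n), Tendsto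
      (fun ε : ℝ => f T * (ε ^ (S \ T).card * ∏ k ∈ T \ S, w k)) (𝓝[>] 0)
      (𝓝 (f T * if S ⊆ T then ∏ k ∈ T \ S, w k else 0)) := by
    intro T
    have hc : Continuous (fun ε : ℝ => f T * (ε ^ (S \ T).card * ∏ k ∈ T \ S, w k)) := by
      fun_prop
    convert (hc.tendsto 0).mono_left nhdsWithin_le_nhds using 2
    by_cases hST : S ⊆ T
    · simp [hST, Finset.sdiff_eq_empty_iff_subset.2 hST]
    · have hne : (S \ T).card ≠ 0 := by
        simpa [Finset.card_eq_zero, Finset.sdiff_eq_empty_iff_subset] using hST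
      simp [hST, zero_pow hne]
  refine (tendsto_finsetSum _ fun T _ => key T).congr' ?_
  filter_upwards [self_mem_nhdsWithin] with ε hε
  have hε : ε ≠ 0 := ne_of_gt hε
  rw [eval_genPoly, Finset.mul_sum]
  refine Finset.sum_congr rfl fun T _ => ?_
  have h1 : ∏ k ∈ T, (if k ∈ S then ε⁻¹ else w k) =
      ε⁻¹ ^ (T ∩ S).card * ∏ k ∈ T \ S, w k := by
    rw [Finset.prod_ite, Finset.prod_const, Finset.filter_mem_eq_inter,
      Finset.filter_notMem_eq_sdiff]
  rw [h1, ← Finset.card_sdiff_add_card_inter S T, Finset.inter_comm T S, pow_add, inv_pow]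
  field_simp

theorem linkEval_midpoint {n : ℕ} {f : Finset (Fin n) → ℝ} (h : LogConcaveOn (genPoly f))
    (S : Finset (Fin n)) {x y : Fin n → ℝ} (hx : ∀ i, 0 ≤ x i) (hy : ∀ i, 0 ≤ y i) :
    linkEval f S x * linkEval f S y ≤ linkEval f S (fun i => (x i + y i) / 2) ^ 2 := by
  refine le_of_tendsto_of_tendsto
    ((tendsto_eval_linkEval f S x).mul (tendsto_eval_linkEval f S y))
    ((tendsto_eval_linkEval f S fun i => (x i + y i) / 2).pow 2) ?_
  filter_upwards [self_mem_nhdsWithin] with ε hε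
  have hε : 0 < ε := hε
  have nonneg : ∀ w : Fin n → ℝ, (∀ i, 0 ≤ w i) →
      ∀ i, 0 ≤ (fun k => if k ∈ S then ε⁻¹ else w k) i := by
    intro w hw i
    dsimp only
    split_ifs
    · positivity
    · exact hw i
  have hm := h.midpoint (nonneg x hx) (nonneg y hy)
  have e : (fun i => ((if i ∈ S then ε⁻¹ else x i) + (if i ∈ S then ε⁻¹ else y i)) / 2) =
      fun i => if i ∈ S then ε⁻¹ else (x i + y i) / 2 := by
    funext i
    split_ifs <;> ring
  rw [e] at hm
  rw [mul_pow, mul_mul_mul_comm, ← sq]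
  exact mul_le_mul_of_nonneg_left hm (by positivity)

theorem linkEval_pair {n : ℕ} (f : Finset (Fin n) → ℝ) {S : Finset (Fin n)} {i j : Fin n}
    (hi : i ∉ S) (hj : j ∉ S) (hij : i ≠ j) (a b : ℝ) :
    linkEval f S (fun k => if k = i then a else if k = j then b else 0) =
      f S + f (insert i S) * a + f (insert j S) * b + f (insert i (insert j S)) * (a * b) := by
  have hiS : i ∉ insert j S := by simp [hij, hi]
  have hsub : linkEval f S (fun k => if k = i then a else if k = j then b else 0) =
      ∑ U ∈ ({i, j} : Finset (Fin n)).powerset,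
        f (S ∪ U) * ∏ k ∈ U, (if k = i then a else if k = j then b else 0) := by
    symm
    unfold linkEval
    have hd : ∀ U ⊆ ({i, j} : Finset (Fin n)), Disjoint U S := by
      intro U hU
      refine Finset.disjoint_of_subset_left hU ?_
      simp [hi, hj]
    refine Finset.sum_of_injOn (fun U => S ∪ U) ?_ (fun _ _ => Finset.mem_univ _) ?_ ?_
    · intro U hU V hV hUV
      have hU := hd U (Finset.mem_powerset.1 hU)
      have hV := hd V (Finset.mem_powerset.1 hV)
      have := congrArg (· \ S) hUV
      simpa [Finset.union_sdiff_distrib, hU.sdiff_eq_left, hV.sdiff_eq_left] using this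
    · intro T _ hT
      by_cases hST : S ⊆ T
      · have : ∃ k ∈ T \ S, k ∉ ({i, j} : Finset (Fin n)) := by
          by_contra! hc
          exact hT ⟨T \ S, Finset.mem_powerset.2 hc, by simp [hST]⟩
        obtain ⟨k, hk, hk'⟩ := this
        simp only [Finset.mem_insert, Finset.mem_singleton, not_or] at hk'
        rw [if_pos hST, Finset.prod_eq_zero hk (by simp [hk'.1, hk'.2]), mul_zero]
      · simp [hST]
    · intro U hU
      have hU := hd U (by simpa using hU)
      simp [Finset.union_sdiff_distrib, hU.sdiff_eq_left]
  have hji : j ≠ i := hij.symm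
  rw [hsub, Finset.sum_powerset_insert (by simpa using hij)]
  rw [show ({j} : Finset (Fin n)) = insert j ∅ from rfl,
    Finset.sum_powerset_insert (by simp), Finset.sum_powerset_insert (by simp)]
  simp [hij, hji, Finset.prod_insert, Finset.union_comm S]
  ring

/-- Midpoint log-concavity of `A + B a + C b + D a b` between the origin and each point of the
nonnegative quadrant bounds the mixed coefficient. -/
theorem mul_le_two_mul_of_midpoint {A B C D : ℝ} (hA : 0 ≤ A) (hB : 0 ≤ B) (hC : 0 ≤ C)
    (hD : 0 ≤ D)
    (h : ∀ a b : ℝ, 0 ≤ a → 0 ≤ b →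
      A * (A + B * (2 * a) + C * (2 * b) + D * ((2 * a) * (2 * b))) ≤
        (A + B * a + C * b + D * (a * b)) ^ 2) :
    A * D ≤ 2 * (B * C) := by
  have hess : ∀ u v : ℝ, 0 ≤ u → 0 ≤ v → 2 * (A * D) * (u * v) ≤ (B * u + C * v) ^ 2 := by
    intro u v hu hv
    have hc : Continuous (fun s : ℝ => (B * u + C * v + s * (D * (u * v))) ^ 2) := by fun_prop
    have ht : Tendsto (fun s : ℝ => (B * u + C * v + s * (D * (u * v))) ^ 2) (𝓝[>] 0)
        (𝓝 ((B * u + C * v) ^ 2)) := by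
      simpa using (hc.tendsto 0).mono_left nhdsWithin_le_nhds
    refine ge_of_tendsto ht ?_
    filter_upwards [self_mem_nhdsWithin] with s hs
    have hs : 0 < s := hs
    have h1 := h (s * u) (s * v) (by positivity) (by positivity)
    have h2 : s ^ 2 * (2 * (A * D) * (u * v)) ≤
        s ^ 2 * (B * u + C * v + s * (D * (u * v))) ^ 2 := by
      linear_combination h1
    exact le_of_mul_le_mul_left h2 (by positivity)
  have hAD : 0 ≤ A * D := mul_nonneg hA hD
  have shift : ∀ ε : ℝ, 0 < ε → A * D * ((C + ε) * (B + ε)) ≤ 2 * ((B + ε) * (C + ε)) ^ 2 := by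
    intro ε hε
    have h1 := hess (C + ε) (B + ε) (by positivity) (by positivity)
    have h2 : (B * (C + ε) + C * (B + ε)) ^ 2 ≤ (2 * ((B + ε) * (C + ε))) ^ 2 := by
      refine pow_le_pow_left₀ (by positivity) ?_ 2
      nlinarith [mul_pos hε hε, mul_nonneg hB hε.le, mul_nonneg hC hε.le]
    linarith
  have hc : Continuous (fun ε : ℝ => 2 * ((B + ε) * (C + ε))) := by fun_prop
  have ht : Tendsto (fun ε : ℝ => 2 * ((B + ε) * (C + ε))) (𝓝[>] 0) (𝓝 (2 * (B * C))) := by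
    simpa using (hc.tendsto 0).mono_left nhdsWithin_le_nhds
  refine ge_of_tendsto ht ?_
  filter_upwards [self_mem_nhdsWithin] with ε hε
  have hε : 0 < ε := hε
  have hpos : 0 < (B + ε) * (C + ε) := by positivity
  refine le_of_mul_le_mul_right ?_ hpos
  linarith [shift ε hε]

/-- If the generating polynomial of a nonnegative set function `f` is
log-concave over the nonnegative orthant, then `f` is almost log-submodular. -/
theorem stmt_7 {n : ℕ} (f : Finset (Fin n) → ℝ) (hf : ∀ S, 0 ≤ f S)
    (h : LogConcaveOn (genPoly f)) :
    ∀ S : Finset (Fin n), ∀ i ∉ S, ∀ j ∉ S, i ≠ j →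
      f S * f (insert i (insert j S)) ≤ 2 * (f (insert i S) * f (insert j S)) := by
  intro S i hi j hj hij
  refine mul_le_two_mul_of_midpoint (hf _) (hf _) (hf _) (hf _) fun a b ha hb => ?_
  have hm := linkEval_midpoint h S
    (x := fun k => if k = i then 0 else if k = j then 0 else 0)
    (y := fun k => if k = i then 2 * a else if k = j then 2 * b else 0)
    (fun k => by simp) (fun k => by split_ifs <;> positivity)
  have e : (fun k => ((if k = i then 0 else if k = j then 0 else 0) +
      (if k = i then 2 * a else if k = j then 2 * b else 0)) / 2) =
      fun k => if k = i then a else if k = j then b else 0 := by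
    funext k
    split_ifs <;> ring
  rw [e, linkEval_pair f hi hj hij, linkEval_pair f hi hj hij, linkEval_pair f hi hj hij] at hm
  simpa using hm
end

section
/- Let a, b, c, d ≥ 0 be reals and consider the polynomial h(y,z) = a + by + cz + dyz ∈ ℝ[y,z]. Then h is log-concave over ℝ²_{≥0} if and only if 2bc ≥ ad. -/
open MvPolynomial

/-- A quadratic that is positive on `[0, 1]` and satisfies `f f'' ≤ f'²` there is log-concave
between the endpoints. -/
lemma quadratic_rpow_mul_rpow_le {A B C : ℝ}
    (hpos : ∀ s ∈ Set.Icc (0 : ℝ) 1, 0 < A + B * s + C * s ^ 2)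
    (hdisc : ∀ s ∈ Set.Icc (0 : ℝ) 1, 2 * C * (A + B * s + C * s ^ 2) ≤ (B + 2 * C * s) ^ 2)
    {t : ℝ} (ht0 : 0 ≤ t) (ht1 : t ≤ 1) :
    (A + B + C) ^ t * A ^ (1 - t) ≤ A + B * t + C * t ^ 2 := by
  have hf : ∀ s : ℝ, HasDerivAt (fun s => A + B * s + C * s ^ 2) (B + 2 * C * s) s := by
    intro s
    refine ((((hasDerivAt_id' s).const_mul B).const_add A).add
      ((hasDerivAt_pow 2 s).const_mul C)).congr_deriv ?_
    push_cast
    ring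
  have hf' : ∀ s : ℝ, HasDerivAt (fun s => B + 2 * C * s) (2 * C) s := by
    intro s
    simpa using ((hasDerivAt_id s).const_mul (2 * C)).const_add B
  have hconc : ConcaveOn ℝ (Set.Icc (0 : ℝ) 1) fun s => Real.log (A + B * s + C * s ^ 2) := by
    refine concaveOn_of_hasDerivWithinAt2_nonpos (convex_Icc 0 1)
      (f' := fun s => (B + 2 * C * s) / (A + B * s + C * s ^ 2))
      (f'' := fun s => (2 * C * (A + B * s + C * s ^ 2) - (B + 2 * C * s) * (B + 2 * C * s)) /
        (A + B * s + C * s ^ 2) ^ 2)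
      (fun s hs => ((hf s).log (hpos s hs).ne').continuousAt.continuousWithinAt) ?_ ?_ ?_
    · intro s hs
      exact ((hf s).log (hpos s (interior_subset hs)).ne').hasDerivWithinAt
    · intro s hs
      exact ((hf' s).div (hf s) (hpos s (interior_subset hs)).ne').hasDerivWithinAt
    · intro s hs
      refine div_nonpos_of_nonpos_of_nonneg ?_ (sq_nonneg _)
      linarith [hdisc s (interior_subset hs)]
  have h0 : 0 < A := by simpa using hpos 0 (by simp)
  have h1 : 0 < A + B + C := by simpa using hpos 1 (by simp)
  have hlog := hconc.2 (x := 1) (y := 0) (by simp) (by simp) ht0 (sub_nonneg.2 ht1) (by ring)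
  simp only [smul_eq_mul, mul_one, mul_zero, add_zero, one_pow, ne_eq, OfNat.ofNat_ne_zero,
    not_false_eq_true, zero_pow] at hlog
  rw [Real.rpow_def_of_pos h1, Real.rpow_def_of_pos h0, ← Real.exp_add,
    ← Real.le_log_iff_exp_le (hpos t ⟨ht0, ht1⟩)]
  linarith

lemma le_of_forall_pos_le_add_mul_add_sq {x y z w : ℝ}
    (h : ∀ s : ℝ, 0 < s → x ≤ y + s * z + s ^ 2 * w) : x ≤ y := by
  have hc : Filter.Tendsto (fun s : ℝ => y + s * z + s ^ 2 * w) (nhdsWithin 0 (Set.Ioi 0))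
      (nhds y) := by
    have : Continuous fun s : ℝ => y + s * z + s ^ 2 * w := by fun_prop
    simpa using (this.tendsto 0).mono_left nhdsWithin_le_nhds
  refine ge_of_tendsto hc ?_
  filter_upwards [self_mem_nhdsWithin] with s hs using h s hs

lemma mul_le_two_mul_of_forall_quadratic {a b c d : ℝ} (ha : 0 ≤ a) (hb : 0 ≤ b) (hc : 0 ≤ c)
    (hd : 0 ≤ d)
    (h : ∀ u v : ℝ, 0 ≤ u → 0 ≤ v → 2 * (a * d) * (u * v) ≤ (b * u + c * v) ^ 2) :
    a * d ≤ 2 * (b * c) := by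
  have had : 0 ≤ a * d := mul_nonneg ha hd
  rcases hb.eq_or_lt with rfl | hb
  · rcases hc.eq_or_lt with rfl | hc
    · linarith [h 1 1 zero_le_one zero_le_one]
    · have := h (c ^ 2) (a * d) (sq_nonneg c) had
      have h2 : c ^ 2 * (a * d) ^ 2 ≤ 0 := by linarith
      have h3 : (a * d) ^ 2 ≤ 0 := nonpos_of_mul_nonpos_right h2 (by positivity)
      nlinarith
  · rcases hc.eq_or_lt with rfl | hc
    · have := h (a * d) (b ^ 2) had (sq_nonneg b)
      have h2 : b ^ 2 * (a * d) ^ 2 ≤ 0 := by linarith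
      have h3 : (a * d) ^ 2 ≤ 0 := nonpos_of_mul_nonpos_right h2 (by positivity)
      nlinarith
    · have := h c b hc.le hb.le
      have hbc : 0 < b * c := mul_pos hb hc
      nlinarith

lemma two_mul_mul_le_sq_of_mul_le {a b c d P Q u v : ℝ} (hb : 0 ≤ b) (hc : 0 ≤ c)
    (had : 0 ≤ a * d) (h : a * d ≤ 2 * (b * c)) (hP : b ≤ P) (hQ : c ≤ Q) :
    2 * (u * v) * (P * Q - b * c + a * d) ≤ (P * u + Q * v) ^ 2 := by
  have hPQ : b * c ≤ P * Q := mul_le_mul hP hQ hc (hb.trans hP)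
  have h1 : 0 ≤ (P * Q + (b * c - a * d)) * (P * u + Q * v) ^ 2 :=
    mul_nonneg (by linarith) (sq_nonneg _)
  have h2 : 0 ≤ (P * Q - (b * c - a * d)) * (P * u - Q * v) ^ 2 :=
    mul_nonneg (by linarith) (sq_nonneg _)
  rcases (hPQ.trans' (mul_nonneg hb hc)).eq_or_lt with h0 | h0
  · have hk : P * Q - b * c + a * d = 0 := by
      have := mul_nonneg hb hc
      linarith
    rw [hk, mul_zero]
    exact sq_nonneg _
  · nlinarith

/-- `h(y,z) = a + b y + c z + d y z` with nonnegative coefficients is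
log-concave over `ℝ²_{≥0}` if and only if `2 b c ≥ a d`. -/
theorem stmt_8 (a b c d : ℝ) (ha : 0 ≤ a) (hb : 0 ≤ b) (hc : 0 ≤ c) (hd : 0 ≤ d) :
    LogConcaveOn (MvPolynomial.C a + MvPolynomial.C b * MvPolynomial.X (0 : Fin 2) +
        MvPolynomial.C c * MvPolynomial.X (1 : Fin 2) +
        MvPolynomial.C d * (MvPolynomial.X (0 : Fin 2) * MvPolynomial.X (1 : Fin 2))) ↔
      a * d ≤ 2 * (b * c) := by
  unfold LogConcaveOn
  simp only [map_add, map_mul, eval_C, eval_X]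
  constructor
  · rintro ⟨-, hlc⟩
    refine mul_le_two_mul_of_forall_quadratic ha hb hc hd fun u v hu hv => ?_
    refine le_of_forall_pos_le_add_mul_add_sq (z := 2 * (b * u + c * v) * (d * (u * v)))
      (w := (d * (u * v)) ^ 2) fun s hs => ?_
    have key := hlc ![0, 0] ![2 * (s * u), 2 * (s * v)] (by simp [Fin.forall_fin_two])
      (by simp only [Fin.forall_fin_two, Matrix.cons_val_zero, Matrix.cons_val_one]
          constructor <;> positivity) (1 / 2) (by norm_num) (by norm_num)
    simp only [Matrix.cons_val_zero, Matrix.cons_val_one, mul_zero, add_zero, zero_add] at key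
    have hhalf : (1 - 1 / 2 : ℝ) = 1 / 2 := by norm_num
    rw [hhalf, ← Real.mul_rpow ha (by positivity), ← Real.sqrt_eq_rpow,
      Real.sqrt_le_iff] at key
    have hs2 : 0 < s ^ 2 := by positivity
    refine le_of_mul_le_mul_left ?_ hs2
    linarith [key.2]
  · intro h
    refine ⟨fun x hx => ?_, fun x y hx hy t ht0 ht1 => ?_⟩
    · have := hx 0
      have := hx 1
      positivity
    obtain ⟨hx0, hx1⟩ := Fin.forall_fin_two.1 hx
    obtain ⟨hy0, hy1⟩ := Fin.forall_fin_two.1 hy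
    generalize x 0 = p, x 1 = q, y 0 = r, y 1 = w at *
    rcases ht0.eq_or_lt with rfl | ht0
    · simp
    rcases ht1.eq_or_lt with rfl | ht1
    · simp
    have ht1' : 0 < 1 - t := sub_pos.2 ht1
    have hm : 0 ≤ a + b * (t * p + (1 - t) * r) + c * (t * q + (1 - t) * w) +
        d * ((t * p + (1 - t) * r) * (t * q + (1 - t) * w)) := by positivity
    have hX : 0 ≤ a + b * p + c * q + d * (p * q) := by positivity
    have hY : 0 ≤ a + b * r + c * w + d * (r * w) := by positivity
    rcases hX.eq_or_lt with hX | hX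
    · rwa [← hX, Real.zero_rpow ht0.ne', zero_mul]
    rcases hY.eq_or_lt with hY | hY
    · rwa [← hY, Real.zero_rpow ht1'.ne', mul_zero]
    have key := quadratic_rpow_mul_rpow_le (A := a + b * r + c * w + d * (r * w))
      (B := (b + d * w) * (p - r) + (c + d * r) * (q - w)) (C := d * ((p - r) * (q - w)))
      ?_ ?_ ht0.le ht1.le
    · convert key using 1
      · congr 2
        ring
      · ring
    · rintro s ⟨hs0, hs1⟩
      have hs1' : 0 ≤ 1 - s := sub_nonneg.2 hs1
      have hrw : 0 ≤ d * (p * w + r * q) := by positivity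
      have hcomb : a + b * r + c * w + d * (r * w) +
          ((b + d * w) * (p - r) + (c + d * r) * (q - w)) * s +
          d * ((p - r) * (q - w)) * s ^ 2 =
          s ^ 2 * (a + b * p + c * q + d * (p * q)) +
          (1 - s) ^ 2 * (a + b * r + c * w + d * (r * w)) +
          s * (1 - s) * (2 * a + b * (p + r) + c * (q + w) + d * (p * w + r * q)) := by ring
      rw [hcomb]
      rcases hs0.eq_or_lt with rfl | hs0
      · simpa using hY
      · positivity
    · rintro s ⟨hs0, hs1⟩
      have hs1' : 0 ≤ 1 - s := sub_nonneg.2 hs1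
      have hP : b ≤ b + d * (s * q + (1 - s) * w) := le_add_of_nonneg_right (by positivity)
      have hQ : c ≤ c + d * (s * p + (1 - s) * r) := le_add_of_nonneg_right (by positivity)
      have := two_mul_mul_le_sq_of_mul_le (u := p - r) (v := q - w) hb hc
        (mul_nonneg ha hd) h hP hQ
      linarith
end
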